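/- Let 1 < q < 2, α, μ > 0 and φ, φ̃ ∈ L¹(ℝ), and let u, ũ be classical solutions of the regularized problem with initial data φ, φ̃ respectively. Then for every t > 0: ∫_ℝ (ũ(t,x) − u(t,x))⁺ dx ≤ ∫_ℝ (φ̃(x) − φ(x))⁺ dx, and ‖ũ(t,·) − u(t,·)‖_{L¹(ℝ)} ≤ ‖φ̃ − φ‖_{L¹(ℝ)}. -/

import Mathlib

open MeasureTheory Filter

/-- `u` is a classical solution of the regularized problem
`u_t + |u|^{q-1} u_x = α (J ∗ u - u) + μ u_xx` with initial datum `φ ∈ L¹(ℝ)`. -/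
def IsRegSol (J : ℝ → ℝ) (q α μ : ℝ) (φ : ℝ → ℝ) (u : ℝ → ℝ → ℝ) : Prop :=
  -- u ∈ C([0,∞); L¹(ℝ))
  (∀ t : ℝ, 0 ≤ t → Integrable (u t)) ∧
  (∀ t₀ : ℝ, 0 ≤ t₀ →
    Tendsto (fun t => ∫ x, |u t x - u t₀ x|) (nhdsWithin t₀ (Set.Ici 0)) (nhds 0)) ∧
  -- u(t,·) ∈ C²(ℝ) for t > 0
  (∀ t : ℝ, 0 < t → ContDiff ℝ 2 (u t)) ∧
  -- u is C¹ in time for t > 0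
  (∀ x : ℝ, ContDiffOn ℝ 1 (fun s => u s x) (Set.Ioi 0)) ∧
  -- the equation holds pointwise for t > 0
  (∀ t : ℝ, 0 < t → ∀ x : ℝ,
    deriv (fun s => u s x) t + |u t x| ^ (q - 1) * deriv (u t) x
      = α * ((∫ y, J (x - y) * u t y) - u t x) + μ * deriv (deriv (u t)) x) ∧
  -- initial datum
  (u 0 =ᵐ[volume] φ)



namespace Perron
open Set Topology

/-- Admissible functionals: densities `e` with formal time derivative given by the second one. -/
structure Adm (ν : Measure ℝ) (s0 t0 : ℝ) (v v' : ℝ → ℝ → ℝ × ℝ) (e e' : ℝ → ℝ → ℝ) : Prop where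
  hd : ∀ x, ∀ t ∈ Icc s0 t0, HasDerivAt (fun s => e s x) (e' t x) t
  hc : ∀ x, ContinuousOn (fun t => e' t x) (Icc s0 t0)
  hi : ∀ t ∈ Icc s0 t0, Integrable (e t) ν
  hm : ∀ t ∈ Icc s0 t0, Measurable (e' t)
  hl : ∃ C : ℝ, 0 ≤ C ∧ (∀ s ∈ Icc s0 t0, ∀ t ∈ Icc s0 t0, ∀ x,
      |e t x - e s x| ≤ C * ‖v t x - v s x‖) ∧ (∀ t ∈ Icc s0 t0, ∀ x, |e' t x| ≤ C * ‖v' t x‖)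

def PP (ν : Measure ℝ) (s0 t0 : ℝ) (v v' : ℝ → ℝ → ℝ × ℝ) (a b : ℝ) : Prop :=
  ∀ (e e' : ℝ → ℝ → ℝ) (l : ℝ), Adm ν s0 t0 v v' e e' →
    (∀ t ∈ Icc s0 t0, ∫ x, e' t x ∂ν ≤ l) →
    (∫ x, e b x ∂ν) - ∫ x, e a x ∂ν ≤ l * (b - a)

def Gaps (S : Set ℝ) : Set (ℝ × ℝ) :=
  {g | g.1 ∈ S ∧ g.2 ∈ S ∧ g.1 < g.2 ∧ Ioo g.1 g.2 ∩ S = ∅}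

lemma gaps_disjoint (S : Set ℝ) : (Gaps S).PairwiseDisjoint (fun g => Ioo g.1 g.2) := by
  rintro ⟨a, b⟩ ⟨ha, hb, hab, h⟩ ⟨c, d⟩ ⟨hc, hd, hcd, h'⟩ hne
  rw [Function.onFun, Set.disjoint_left]
  rintro x ⟨h1, h2⟩ ⟨h3, h4⟩
  simp only at *
  apply hne
  have key : ∀ y ∈ S, ¬ (a < y ∧ y < b) := fun y hy hh => by
    have : y ∈ Ioo a b ∩ S := ⟨hh, hy⟩
    simp [h] at this
  have key' : ∀ y ∈ S, ¬ (c < y ∧ y < d) := fun y hy hh => by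
    have : y ∈ Ioo c d ∩ S := ⟨hh, hy⟩
    simp [h'] at this
  have e1 : a = c := by
    rcases lt_trichotomy a c with hh | hh | hh
    · exact absurd ⟨hh, by linarith⟩ (key c hc)
    · exact hh
    · exact absurd ⟨hh, by linarith⟩ (key' a ha)
  have e2 : b = d := by
    rcases lt_trichotomy b d with hh | hh | hh
    · exact absurd ⟨by linarith, hh⟩ (key' b hb)
    · exact hh
    · exact absurd ⟨by linarith, hh⟩ (key d hd)
  rw [e1, e2]

lemma gaps_countable (S : Set ℝ) : (Gaps S).Countable :=
  (gaps_disjoint S).countable_of_isOpen (fun _ _ => isOpen_Ioo)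
    (fun _ hg => nonempty_Ioo.2 hg.2.2.1)

lemma gaps_union {S : Set ℝ} {α β : ℝ} (hS : IsClosed S) (hsub : S ⊆ Icc α β)
    (hα : α ∈ S) (hβ : β ∈ S) :
    Icc α β \ S = ⋃ g : Gaps S, Ioo g.1.1 g.1.2 := by
  ext x
  simp only [Set.mem_sdiff, mem_iUnion]
  constructor
  · rintro ⟨hx, hxS⟩
    have hc1 : IsCompact (S ∩ Icc α x) := by
      exact isCompact_Icc.inter_left hS
    have hc2 : IsCompact (S ∩ Icc x β) := isCompact_Icc.inter_left hS
    have hn1 : (S ∩ Icc α x).Nonempty := ⟨α, hα, le_rfl, hx.1⟩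
    have hn2 : (S ∩ Icc x β).Nonempty := ⟨β, hβ, hx.2, le_rfl⟩
    have m1 := hc1.sSup_mem hn1
    have m2 := hc2.sInf_mem hn2
    have l1 : sSup (S ∩ Icc α x) < x := lt_of_le_of_ne m1.2.2 (fun h => hxS (h ▸ m1.1))
    have l2 : x < sInf (S ∩ Icc x β) := lt_of_le_of_ne m2.2.1 (fun h => hxS (h ▸ m2.1))
    refine ⟨⟨(_, _), m1.1, m2.1, l1.trans l2, ?_⟩, l1, l2⟩
    rw [Set.eq_empty_iff_forall_notMem]
    rintro y ⟨⟨h1, h2⟩, hy⟩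
    rcases le_total y x with h | h
    · exact absurd (le_csSup hc1.bddAbove ⟨hy, (hsub hy).1, h⟩) (not_le.2 h1)
    · exact absurd (csInf_le hc2.bddBelow ⟨hy, h, (hsub hy).2⟩) (not_le.2 h2)
  · rintro ⟨⟨⟨a, b⟩, ha, hb, hab, h⟩, hx⟩
    refine ⟨⟨(hsub ha).1.trans hx.1.le, hx.2.le.trans (hsub hb).2⟩, fun hxS => ?_⟩
    have : x ∈ Ioo a b ∩ S := ⟨hx, hxS⟩
    simp only at h
    simp [h] at this

/-- Decomposition of the increment of a `C¹` function along a closed set and its gaps. -/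
lemma gap_decomp {S : Set ℝ} {α β : ℝ} (hS : IsClosed S) (hsub : S ⊆ Icc α β)
    (hα : α ∈ S) (hβ : β ∈ S) (f f' : ℝ → ℝ) (hd : ∀ t ∈ Icc α β, HasDerivAt f (f' t) t)
    (hc : ContinuousOn f' (Icc α β)) :
    HasSum (fun g : Gaps S => f g.1.2 - f g.1.1) (f β - f α - ∫ t in S, f' t) := by
  have hab : α ≤ β := (hsub hα).2
  have : Countable (Gaps S) := (gaps_countable S).to_subtype
  have hIntg : IntegrableOn f' (Icc α β) := hc.integrableOn_Icc
  have hu := gaps_union hS hsub hα hβ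
  have h1 := hasSum_integral_iUnion (μ := volume) (f := f') (s := fun g : Gaps S => Ioo g.1.1 g.1.2)
    (fun _ => measurableSet_Ioo) (fun i j hij => gaps_disjoint S i.2 j.2 (fun h => hij (Subtype.ext h)))
    (by rw [← hu]; exact hIntg.mono_set Set.sdiff_subset)
  rw [← hu, setIntegral_sdiff hS.measurableSet hIntg hsub] at h1
  have ftc : ∀ a b, a ≤ b → Icc a b ⊆ Icc α β → ∫ t in Ioc a b, f' t = f b - f a := by
    intro a b hab' hs
    rw [← intervalIntegral.integral_of_le hab']
    apply intervalIntegral.integral_eq_sub_of_hasDerivAt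
    · intro t ht; rw [uIcc_of_le hab'] at ht; exact hd t (hs ht)
    · rw [intervalIntegrable_iff_integrableOn_Icc_of_le hab']; exact hIntg.mono_set hs
  rw [integral_Icc_eq_integral_Ioc, ftc α β hab le_rfl] at h1
  convert! h1 using 2 with g
  rw [← integral_Ioc_eq_integral_Ioo, ftc _ _ g.2.2.2.1.le]
  exact Icc_subset_Icc (hsub g.2.1).1 (hsub g.2.2.1).2

lemma main_gap {ν : Measure ℝ} [SFinite ν] {s0 t0 : ℝ} {v v' : ℝ → ℝ → ℝ × ℝ}
    (hvi : ∀ t ∈ Icc s0 t0, Integrable (v t) ν)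
    {S : Set ℝ} {α β : ℝ} (hS : IsClosed S) (hsub : S ⊆ Icc α β)
    (hα : α ∈ S) (hβ : β ∈ S) (hsub0 : Icc α β ⊆ Icc s0 t0) (M C0 : ℝ)
    (hv' : ∀ t ∈ S, Integrable (v' t) ν ∧ ∫ x, ‖v' t x‖ ∂ν ≤ M)
    (hP : ∀ g ∈ Gaps S, PP ν s0 t0 v v' g.1 g.2)
    (hG : ∀ g ∈ Gaps S, ∫ x, ‖v g.2 x - v g.1 x‖ ∂ν ≤ C0 * (g.2 - g.1)) :
    PP ν s0 t0 v v' α β := by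
  intro e e' l hA hl
  obtain ⟨C, hC0, hC, hC'⟩ := hA.hl
  have : Countable (Gaps S) := (gaps_countable S).to_subtype
  have hab : α ≤ β := (hsub hα).2
  have hdec : ∀ x, HasSum (fun g : Gaps S => e g.1.2 x - e g.1.1 x)
      (e β x - e α x - ∫ t in S, e' t x) := fun x =>
    gap_decomp hS hsub hα hβ (fun t => e t x) (fun t => e' t x)
      (fun t ht => hA.hd x t (hsub0 ht)) ((hA.hc x).mono hsub0)
  have hlen : HasSum (fun g : Gaps S => g.1.2 - g.1.1) (β - α - ∫ t in S, (1:ℝ)) :=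
    gap_decomp hS hsub hα hβ (fun t => t) (fun t => 1) (fun t _ => hasDerivAt_id t)
      continuousOn_const
  have hmem : ∀ t ∈ S, t ∈ Icc s0 t0 := fun t ht => hsub0 (hsub ht)
  have hei : ∀ g : Gaps S, Integrable (fun x => e g.1.2 x - e g.1.1 x) ν := fun g =>
    (hA.hi _ (hmem _ g.2.2.1)).sub (hA.hi _ (hmem _ g.2.1))
  have hbd : ∀ g : Gaps S, ∫ x, ‖e g.1.2 x - e g.1.1 x‖ ∂ν ≤ C * (C0 * (g.1.2 - g.1.1)) := by
    intro g
    calc ∫ x, ‖e g.1.2 x - e g.1.1 x‖ ∂ν ≤ ∫ x, C * ‖v g.1.2 x - v g.1.1 x‖ ∂ν := by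
          apply integral_mono (hei g).norm
          · exact (((hvi _ (hmem _ g.2.2.1)).sub (hvi _ (hmem _ g.2.1))).norm).const_mul C
          · intro x; exact hC _ (hmem _ g.2.1) _ (hmem _ g.2.2.1) x
      _ = C * ∫ x, ‖v g.1.2 x - v g.1.1 x‖ ∂ν := integral_const_mul _ _
      _ ≤ _ := mul_le_mul_of_nonneg_left (hG _ g.2) hC0
  have hsum : Summable (fun g : Gaps S => ∫ x, ‖e g.1.2 x - e g.1.1 x‖ ∂ν) :=
    Summable.of_nonneg_of_le (fun g => integral_nonneg (fun x => norm_nonneg _)) hbd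
      ((hlen.summable.mul_left C0).mul_left C)
  have hI := hasSum_integral_of_summable_integral_norm hei hsum
  have hle : ∑' g : Gaps S, (∫ x, (e g.1.2 x - e g.1.1 x) ∂ν) ≤ l * (β - α - ∫ t in S, (1:ℝ)) := by
    rw [← hlen.tsum_eq, ← tsum_mul_left]
    apply Summable.tsum_le_tsum _ hI.summable (hlen.summable.mul_left l)
    intro g
    rw [integral_sub (hA.hi _ (hmem _ g.2.2.1)) (hA.hi _ (hmem _ g.2.1))]
    exact hP _ g.2 e e' l hA hl
  rw [hI.tsum_eq] at hle
  simp_rw [fun x => (hdec x).tsum_eq] at hle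
  -- Fubini on S
  set cl : ℝ → ℝ := fun t => max α (min t β) with hcl
  have hclm : ∀ t, cl t ∈ Icc α β := fun t => ⟨le_max_left _ _, max_le hab (min_le_right _ _)⟩
  have hcls : ∀ t ∈ S, cl t = t := fun t ht => by
    have := hsub ht
    simp only [hcl]; rw [min_eq_left this.2, max_eq_right this.1]
  have hclc : Continuous cl := by fun_prop
  have hmeas : StronglyMeasurable (Function.uncurry (fun t x => e' (cl t) x)) := by
    apply stronglyMeasurable_uncurry_of_continuous_of_stronglyMeasurable
    · intro x
      exact ((hA.hc x).mono hsub0).comp_continuous hclc hclm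
    · intro t; exact (hA.hm _ (hsub0 (hclm t))).stronglyMeasurable
  have hfinS : volume S ≠ ⊤ := ((measure_mono hsub).trans_lt (by simp)).ne
  have hInt : Integrable (Function.uncurry (fun t x => e' (cl t) x))
      ((volume.restrict S).prod ν) := by
    rw [integrable_prod_iff hmeas.aestronglyMeasurable]
    have hx : ∀ t ∈ S, Integrable (e' t) ν := fun t ht =>
      ((hv' t ht).1.norm.const_mul C).mono' (hA.hm t (hmem t ht)).aestronglyMeasurable
        (Eventually.of_forall (fun x => hC' t (hmem t ht) x))
    constructor
    · filter_upwards [ae_restrict_mem hS.measurableSet] with t ht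
      simp only [Function.uncurry, hcls t ht]
      exact hx t ht
    · have : IsFiniteMeasure (volume.restrict S) := ⟨by simpa using hfinS.lt_top⟩
      refine (integrable_const (C * M)).mono' ?_ ?_
      · exact hmeas.norm.aestronglyMeasurable.integral_prod_right'
      · filter_upwards [ae_restrict_mem hS.measurableSet] with t ht
        simp only [Function.uncurry, hcls t ht]
        rw [Real.norm_of_nonneg (integral_nonneg (fun x => norm_nonneg _))]
        calc ∫ x, ‖e' t x‖ ∂ν ≤ ∫ x, C * ‖v' t x‖ ∂ν :=
              integral_mono (hx t ht).norm ((hv' t ht).1.norm.const_mul C)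
                (fun x => hC' t (hmem t ht) x)
          _ = C * ∫ x, ‖v' t x‖ ∂ν := integral_const_mul _ _
          _ ≤ _ := mul_le_mul_of_nonneg_left (hv' t ht).2 hC0
  have hcongr : ∀ x, ∫ t in S, e' (cl t) x = ∫ t in S, e' t x := fun x =>
    setIntegral_congr_fun hS.measurableSet (fun t ht => by simp only [hcls t ht])
  have hIS : Integrable (fun x => ∫ t in S, e' t x) ν := by
    have := hInt.integral_prod_right
    simp only [Function.uncurry] at this
    exact this.congr (Eventually.of_forall hcongr)
  have hsw : ∫ x, (∫ t in S, e' t x) ∂ν ≤ l * ∫ t in S, (1:ℝ) := by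
    have h1 := integral_integral_swap hInt
    simp_rw [hcongr] at h1
    rw [← h1, ← integral_const_mul]
    apply setIntegral_mono_on
    · exact hInt.integral_prod_left
    · simp [integrableOn_const_iff, hfinS.lt_top]
    · exact hS.measurableSet
    · intro t ht
      simp only [hcls t ht, mul_one]
      exact hl t (hmem t ht)
  have hαβ : Integrable (fun x => e β x - e α x) ν := (hA.hi _ (hmem _ hβ)).sub (hA.hi _ (hmem _ hα))
  rw [integral_sub hαβ hIS,
    integral_sub (hA.hi _ (hmem _ hβ)) (hA.hi _ (hmem _ hα))] at hle
  nlinarith [hle, hsw]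

end Perron


namespace Perron
open Set Topology

lemma PP.refl {ν : Measure ℝ} {s0 t0 : ℝ} {v v' : ℝ → ℝ → ℝ × ℝ} (a : ℝ) :
    PP ν s0 t0 v v' a a := by
  intro e e' l _ _; simp

lemma PP.trans {ν : Measure ℝ} {s0 t0 : ℝ} {v v' : ℝ → ℝ → ℝ × ℝ} {a b c : ℝ}
    (h1 : PP ν s0 t0 v v' a b) (h2 : PP ν s0 t0 v v' b c) : PP ν s0 t0 v v' a c := by
  intro e e' l hA hl
  have := h1 e e' l hA hl
  have := h2 e e' l hA hl
  linarith

lemma Adm.cont {ν : Measure ℝ} {s0 t0 : ℝ} {v v' : ℝ → ℝ → ℝ × ℝ} {e e' : ℝ → ℝ → ℝ}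
    (hA : Adm ν s0 t0 v v' e e') (hvi : ∀ t ∈ Icc s0 t0, Integrable (v t) ν)
    (hvc : ∀ s ∈ Icc s0 t0, Tendsto (fun t => ∫ x, ‖v t x - v s x‖ ∂ν) (𝓝[Icc s0 t0] s) (𝓝 0)) :
    ContinuousOn (fun t => ∫ x, e t x ∂ν) (Icc s0 t0) := by
  obtain ⟨C, hC0, hC, _⟩ := hA.hl
  intro s hs
  rw [ContinuousWithinAt, tendsto_iff_dist_tendsto_zero]
  have h0 := (hvc s hs).const_mul C
  rw [mul_zero] at h0
  refine squeeze_zero' (Eventually.of_forall fun _ => dist_nonneg) ?_ h0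
  filter_upwards [self_mem_nhdsWithin] with t ht
  rw [Real.dist_eq, ← integral_sub (hA.hi t ht) (hA.hi s hs), ← integral_const_mul]
  refine (norm_integral_le_integral_norm (fun x => e t x - e s x)).trans ?_
  apply integral_mono ((hA.hi t ht).sub (hA.hi s hs)).norm
  · exact (((hvi _ ht).sub (hvi _ hs)).norm).const_mul C
  · intro x; exact hC _ hs _ ht x

/-- a continuous function which is locally antitone in the interior is antitone -/
lemma loc_antitone {f : ℝ → ℝ} {a b : ℝ} (hab : a ≤ b) (hf : ContinuousOn f (Icc a b))
    (h : ∀ x ∈ Ioo a b, ∃ δ > 0, ∀ y, x ≤ y → y < x + δ → y < b → f y ≤ f x) : f b ≤ f a := by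
  rcases hab.eq_or_lt with rfl | hab
  · exact le_rfl
  have key : ∀ c ∈ Ioo a b, f b ≤ f c := by
    intro c hc
    have key2 : ∀ d ∈ Ioo c b, f d ≤ f c := by
      intro d hd
      have hsub : Icc c d ⊆ Icc a b := Icc_subset_Icc hc.1.le hd.2.le
      have hcl : IsClosed ({x | f x ≤ f c} ∩ Icc c d) := by
        have := (hf.mono hsub).preimage_isClosed_of_isClosed isClosed_Icc (isClosed_Iic (a := f c))
        rwa [inter_comm] at this
      have := hcl.Icc_subset_of_forall_exists_gt (le_refl (f c)) (by
        rintro x ⟨hx1, hx2⟩ y hy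
        obtain ⟨δ, hδ, hh⟩ := h x ⟨hc.1.trans_le hx2.1, hx2.2.trans hd.2⟩
        have hxd := hx2.2
        have hy' : x < y := hy
        refine ⟨min (min y d) (x + δ/2), ?_, ?_, ?_⟩
        · refine (hh _ ?_ ?_ ?_).trans hx1
          · exact le_min (le_min hy'.le hxd.le) (by linarith)
          · exact (min_le_right _ _).trans_lt (by linarith)
          · exact ((min_le_left _ _).trans (min_le_right _ _)).trans_lt hd.2
        · exact lt_min (lt_min hy' hxd) (by linarith)
        · exact (min_le_left _ _).trans (min_le_left _ _))
      exact this ⟨hd.1.le, le_rfl⟩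
    have hb : Tendsto f (𝓝[Ioo c b] b) (𝓝 (f b)) :=
      (hf b ⟨hab.le, le_rfl⟩).mono (Ioo_subset_Icc_self.trans (Icc_subset_Icc hc.1.le le_rfl))
    have : (𝓝[Ioo c b] b).NeBot := by
      rw [nhdsWithin_Ioo_eq_nhdsLT hc.2]; infer_instance
    exact le_of_tendsto hb (by filter_upwards [self_mem_nhdsWithin] with d hd using key2 d hd)
  have ha : Tendsto f (𝓝[Ioo a b] a) (𝓝 (f a)) :=
    (hf a ⟨le_rfl, hab.le⟩).mono Ioo_subset_Icc_self
  have : (𝓝[Ioo a b] a).NeBot := by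
    rw [nhdsWithin_Ioo_eq_nhdsGT hab]; infer_instance
  exact ge_of_tendsto ha (by filter_upwards [self_mem_nhdsWithin] with d hd using key d hd)

theorem perron {ν : Measure ℝ} [SFinite ν] {s0 t0 : ℝ} (h0 : s0 ≤ t0) {v v' : ℝ → ℝ → ℝ × ℝ}
    (hvi : ∀ t ∈ Icc s0 t0, Integrable (v t) ν)
    (hvc : ∀ s ∈ Icc s0 t0, Tendsto (fun t => ∫ x, ‖v t x - v s x‖ ∂ν) (𝓝[Icc s0 t0] s) (𝓝 0))
    (B : ℕ → Set ℝ) (hB : ∀ k, IsClosed (B k)) (hBu : Icc s0 t0 ⊆ ⋃ k, B k)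
    (hv' : ∀ k, ∃ M : ℝ, ∀ t ∈ B k ∩ Icc s0 t0, Integrable (v' t) ν ∧ ∫ x, ‖v' t x‖ ∂ν ≤ M)
    (hG : ∀ k, ∃ C : ℝ, ∀ a ∈ B k ∩ Icc s0 t0, ∀ b ∈ Icc s0 t0, a < b → PP ν s0 t0 v v' a b →
      ∫ x, ‖v b x - v a x‖ ∂ν ≤ C * (b - a)) :
    PP ν s0 t0 v v' s0 t0 := by
  set S : Set ℝ := {t | t ∈ Icc s0 t0 ∧ ∀ δ > 0, ∃ a ∈ Icc s0 t0, ∃ b ∈ Icc s0 t0,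
    t - δ < a ∧ a ≤ b ∧ b < t + δ ∧ ¬ PP ν s0 t0 v v' a b} with hSdef
  have hSc : IsClosed S := by
    rw [← isOpen_compl_iff, Metric.isOpen_iff]
    intro t ht
    by_cases hti : t ∈ Icc s0 t0
    · have : ∃ δ > 0, ∀ a ∈ Icc s0 t0, ∀ b ∈ Icc s0 t0, t - δ < a → a ≤ b → b < t + δ →
          PP ν s0 t0 v v' a b := by
        by_contra hcon
        apply ht
        refine ⟨hti, fun δ hδ => ?_⟩
        by_contra hc2
        apply hcon
        refine ⟨δ, hδ, fun a ha b hb h1 h2 h3 => ?_⟩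
        by_contra hc3
        exact hc2 ⟨a, ha, b, hb, h1, h2, h3, hc3⟩
      obtain ⟨δ, hδ, hh⟩ := this
      refine ⟨δ/2, by linarith, fun s hs hsS => ?_⟩
      rw [Metric.mem_ball, Real.dist_eq, abs_lt] at hs
      obtain ⟨a, ha, b, hb, h1, h2, h3, h4⟩ := hsS.2 (δ/2) (by linarith)
      exact h4 (hh a ha b hb (by linarith) h2 (by linarith))
    · obtain ⟨ε, hε, hh⟩ := Metric.isOpen_iff.1 (isClosed_Icc (a := s0) (b := t0)).isOpen_compl t hti
      exact ⟨ε, hε, fun s hs hsS => hh hs hsS.1⟩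
  -- no bad points inside implies PP
  have L2 : ∀ a ∈ Icc s0 t0, ∀ b ∈ Icc s0 t0, a ≤ b → Ioo a b ∩ S = ∅ → PP ν s0 t0 v v' a b := by
    intro a ha b hb hab hemp e e' l hA hl
    have hsub : Icc a b ⊆ Icc s0 t0 := Icc_subset_Icc ha.1 hb.2
    have := loc_antitone (f := fun t => (∫ x, e t x ∂ν) - l * t) hab
      (((hA.cont hvi hvc).mono hsub).sub (by fun_prop)) (by
        intro x hx
        have hxi : x ∈ Icc s0 t0 := hsub (Ioo_subset_Icc_self hx)
        have hxS : x ∉ S := fun hxS => by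
          have : x ∈ Ioo a b ∩ S := ⟨hx, hxS⟩
          simp [hemp] at this
        have : ¬ ∀ δ > 0, ∃ a ∈ Icc s0 t0, ∃ b ∈ Icc s0 t0,
          x - δ < a ∧ a ≤ b ∧ b < x + δ ∧ ¬ PP ν s0 t0 v v' a b := fun hc => hxS ⟨hxi, hc⟩
        push Not at this
        obtain ⟨δ, hδ, hh⟩ := this
        refine ⟨δ, hδ, fun y hy1 hy2 hy3 => ?_⟩
        have := hh x hxi y ⟨hxi.1.trans hy1, hy3.le.trans hb.2⟩ (by linarith) hy1 hy2 e e' l hA hl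
        linarith)
    linarith
  have hempty : S = ∅ := by
    by_contra hne
    rw [← Ne, ← nonempty_iff_ne_empty] at hne
    have : Nonempty S := hne.to_subtype
    have : CompleteSpace S := hSc.completeSpace_coe
    obtain ⟨k, hk⟩ := nonempty_interior_of_iUnion_of_closed (X := S)
      (f := fun k => (Subtype.val ⁻¹' (B k) : Set S))
      (fun k => (hB k).preimage continuous_subtype_val) (by
        rw [← preimage_iUnion]
        ext ⟨x, hx⟩
        simpa using hBu hx.1)
    obtain ⟨⟨x, hxS⟩, hx⟩ := hk
    rw [mem_interior_iff_mem_nhds, Metric.mem_nhds_iff] at hx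
    obtain ⟨δ, hδ, hball⟩ := hx
    have hSB : ∀ t ∈ S, x - δ < t → t < x + δ → t ∈ B k := fun t ht h1 h2 => by
      have : (⟨t, ht⟩ : S) ∈ Metric.ball (⟨x, hxS⟩ : S) δ := by
        rw [Metric.mem_ball, Subtype.dist_eq, Real.dist_eq, abs_lt]; constructor <;> simp <;> linarith
      exact hball this
    obtain ⟨a, ha, b, hb, h1, h2, h3, h4⟩ := hxS.2 δ hδ
    apply h4
    by_cases hemp : Icc a b ∩ S = ∅
    · apply L2 a ha b hb h2
      rw [eq_empty_iff_forall_notMem] at hemp ⊢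
      exact fun y hy => hemp y ⟨Ioo_subset_Icc_self hy.1, hy.2⟩
    rw [← Ne, ← nonempty_iff_ne_empty] at hemp
    have hcomp : IsCompact (Icc a b ∩ S) := isCompact_Icc.inter_right hSc
    have hsi : Icc a b ⊆ Icc s0 t0 := Icc_subset_Icc ha.1 hb.2
    obtain ⟨M, hM⟩ := hv' k
    obtain ⟨C, hC⟩ := hG k
    have mα := hcomp.sInf_mem hemp
    have mβ := hcomp.sSup_mem hemp
    set α := sInf (Icc a b ∩ S)
    set β := sSup (Icc a b ∩ S)
    have hsub : Icc a b ∩ S ⊆ Icc α β := fun y hy =>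
      ⟨csInf_le hcomp.bddBelow hy, le_csSup hcomp.bddAbove hy⟩
    have hsub1 : Icc α β ⊆ Icc a b := Icc_subset_Icc mα.1.1 mβ.1.2
    have p1 : PP ν s0 t0 v v' a α := by
      apply L2 a ha α (hsi mα.1) mα.1.1
      rw [eq_empty_iff_forall_notMem]
      rintro y ⟨hy, hyS⟩
      exact absurd (hsub ⟨⟨hy.1.le, hy.2.le.trans mα.1.2⟩, hyS⟩).1 (not_le.2 hy.2)
    have p3 : PP ν s0 t0 v v' β b := by
      apply L2 β (hsi mβ.1) b hb mβ.1.2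
      rw [eq_empty_iff_forall_notMem]
      rintro y ⟨hy, hyS⟩
      exact absurd (hsub ⟨⟨mβ.1.1.trans hy.1.le, hy.2.le⟩, hyS⟩).2 (not_le.2 hy.1)
    have hB' : ∀ t ∈ Icc a b ∩ S, t ∈ B k ∩ Icc s0 t0 := fun t ht =>
      ⟨hSB t ht.2 (by linarith [ht.1.1]) (by linarith [ht.1.2]), hsi ht.1⟩
    have hP : ∀ g ∈ Gaps (Icc a b ∩ S), PP ν s0 t0 v v' g.1 g.2 := by
      rintro ⟨c, d⟩ ⟨hc, hd, hcd, hem⟩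
      apply L2 c (hsi hc.1) d (hsi hd.1) hcd.le
      rw [eq_empty_iff_forall_notMem] at hem ⊢
      rintro y ⟨hy, hyS⟩
      exact hem y ⟨hy, ⟨hc.1.1.trans hy.1.le, hy.2.le.trans hd.1.2⟩, hyS⟩
    have p2 : PP ν s0 t0 v v' α β :=
      main_gap hvi hcomp.isClosed hsub mα mβ (hsub1.trans hsi) M C
        (fun t ht => hM t (hB' t ht)) hP
        (fun g hg => hC _ (hB' _ hg.1) _ (hsi hg.2.1.1) hg.2.2.1 (hP g hg))
    exact (p1.trans p2).trans p3
  exact L2 s0 ⟨le_rfl, h0⟩ t0 ⟨h0, le_rfl⟩ h0 (by simp [hempty])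

end Perron


namespace Perron
open Set Topology

noncomputable def eta (ε w : ℝ) : ℝ := (w + √(w^2 + ε^2)) / 2
noncomputable def eta1 (ε w : ℝ) : ℝ := (1 + w / √(w^2 + ε^2)) / 2
noncomputable def eta2 (ε w : ℝ) : ℝ := ε^2 / (w^2 + ε^2) / (2 * √(w^2 + ε^2))


lemma eta_pos {ε : ℝ} (hε : 0 < ε) (w : ℝ) : 0 < w^2 + ε^2 := by positivity

lemma sq_le {ε : ℝ} (hε : 0 < ε) (w : ℝ) : |w| ≤ √(w^2 + ε^2) := by
  apply Real.abs_le_sqrt; nlinarith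

lemma eps_le {ε : ℝ} (hε : 0 < ε) (w : ℝ) : ε ≤ √(w^2 + ε^2) := by
  apply Real.le_sqrt_of_sq_le; nlinarith [sq_nonneg w]

lemma sq_le' {ε : ℝ} (hε : 0 < ε) (w : ℝ) : √(w^2 + ε^2) ≤ |w| + ε := by
  apply Real.sqrt_le_iff.2 ⟨by positivity, ?_⟩
  nlinarith [sq_abs w, abs_nonneg w]

lemma hasDerivAt_sq {ε : ℝ} (hε : 0 < ε) (w : ℝ) : HasDerivAt (fun w => √(w^2 + ε^2)) (w / √(w^2 + ε^2)) w := by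
  have h := ((hasDerivAt_pow 2 w).add_const (ε^2)).sqrt (eta_pos hε w).ne'
  convert h using 1
  have hs : √(w^2 + ε^2) ≠ 0 := (Real.sqrt_pos.2 (eta_pos hε w)).ne'
  field_simp
  norm_num; ring

lemma hasDerivAt_eta {ε : ℝ} (hε : 0 < ε) (w : ℝ) : HasDerivAt (eta ε) (eta1 ε w) w := by
  exact ((hasDerivAt_id w).add (hasDerivAt_sq hε w)).div_const 2

lemma hasDerivAt_eta1 {ε : ℝ} (hε : 0 < ε) (w : ℝ) : HasDerivAt (eta1 ε) (eta2 ε w) w := by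
  have hs : √(w^2 + ε^2) ≠ 0 := (Real.sqrt_pos.2 (eta_pos hε w)).ne'
  have h := ((((hasDerivAt_id' w).div (hasDerivAt_sq hε w) hs)).const_add 1).div_const 2
  refine HasDerivAt.congr_deriv (f := eta1 ε) h ?_
  unfold eta2
  have h2 : √(w^2 + ε^2)^2 = w^2 + ε^2 := Real.sq_sqrt (eta_pos hε w).le
  have h3 := eta_pos hε w
  field_simp
  rw [h2]; ring

lemma eta1_nonneg {ε : ℝ} (hε : 0 < ε) (w : ℝ) : 0 ≤ eta1 ε w := by
  have := sq_le hε w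
  have hs : 0 < √(w^2 + ε^2) := (Real.sqrt_pos.2 (eta_pos hε w))
  have : -1 ≤ w / √(w^2 + ε^2) := by rw [le_div_iff₀ hs]; linarith [neg_abs_le w]
  unfold eta1; linarith

lemma eta1_le {ε : ℝ} (hε : 0 < ε) (w : ℝ) : eta1 ε w ≤ 1 := by
  have := sq_le hε w
  have hs : 0 < √(w^2 + ε^2) := (Real.sqrt_pos.2 (eta_pos hε w))
  have : w / √(w^2 + ε^2) ≤ 1 := by rw [div_le_iff₀ hs]; linarith [le_abs_self w]
  unfold eta1; linarith

lemma eta2_nonneg {ε : ℝ} (hε : 0 < ε) (w : ℝ) : 0 ≤ eta2 ε w := by unfold eta2; positivity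

lemma eta2_mul {ε : ℝ} (hε : 0 < ε) (w : ℝ) : eta2 ε w * w^2 ≤ ε / 2 := by
  have hs : 0 < √(w^2 + ε^2) := (Real.sqrt_pos.2 (eta_pos hε w))
  have h1 := eps_le hε w
  have h3 := eta_pos hε w
  unfold eta2
  rw [div_div, div_mul_eq_mul_div, div_le_div_iff₀ (by positivity) (by norm_num)]
  have : ε * w^2 ≤ (w^2+ε^2) * √(w^2+ε^2) := by
    have : w^2 * ε ≤ (w^2+ε^2) * √(w^2+ε^2) := by
      apply mul_le_mul _ h1 hε.le h3.le
      nlinarith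
    linarith
  nlinarith [mul_le_mul_of_nonneg_left this hε.le]

lemma le_eta {ε : ℝ} (hε : 0 < ε) (w : ℝ) : max w 0 ≤ eta ε w := by
  have := sq_le hε w
  unfold eta
  apply max_le <;> linarith [neg_abs_le w, le_abs_self w]

lemma eta_le {ε : ℝ} (hε : 0 < ε) (w : ℝ) : eta ε w ≤ max w 0 + ε / 2 := by
  have := sq_le' hε w
  unfold eta
  rcases le_total 0 w with h | h
  · rw [max_eq_left h]; rw [abs_of_nonneg h] at this; linarith
  · rw [max_eq_right h]; rw [abs_of_nonpos h] at this; linarith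

lemma eta_le_abs {ε : ℝ} (hε : 0 < ε) (w : ℝ) : eta ε w ≤ |w| + ε := by
  have := eta_le hε w
  have : max w 0 ≤ |w| := max_le (le_abs_self _) (abs_nonneg _)
  linarith

lemma le_mul_eta1 {ε : ℝ} (hε : 0 < ε) (w : ℝ) : max w 0 - ε / 2 ≤ w * eta1 ε w := by
  have hs : 0 < √(w^2 + ε^2) := (Real.sqrt_pos.2 (eta_pos hε w))
  have h1 := eps_le hε w
  have h2 : √(w^2 + ε^2)^2 = w^2 + ε^2 := Real.sq_sqrt (eta_pos hε w).le
  have h3 := le_eta hε w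
  have : eta ε w - ε / 2 ≤ w * eta1 ε w := by
    unfold eta eta1
    have : w * (w / √(w^2+ε^2)) = √(w^2+ε^2) - ε^2 / √(w^2+ε^2) := by
      field_simp; rw [h2]; ring
    have h4 : ε^2 / √(w^2+ε^2) ≤ ε := by rw [div_le_iff₀ hs]; nlinarith
    linarith
  linarith

lemma eta_lip {ε : ℝ} (hε : 0 < ε) (a b : ℝ) : |eta ε a - eta ε b| ≤ |a - b| := by
  have := Convex.norm_image_sub_le_of_norm_hasDerivWithin_le (f := eta ε) (f' := eta1 ε) (C := 1)
    (s := univ) (x := b) (y := a) (fun x _ => (hasDerivAt_eta hε x).hasDerivWithinAt)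
    (fun x _ => by rw [Real.norm_of_nonneg (eta1_nonneg hε x)]; exact eta1_le hε x) convex_univ
    (mem_univ _) (mem_univ _)
  simpa using this

lemma continuous_eta (ε : ℝ) : Continuous (eta ε) := by unfold eta; fun_prop
lemma continuous_eta1 {ε : ℝ} (hε : 0 < ε) : Continuous (eta1 ε) :=
  continuous_iff_continuousAt.2 fun w => (hasDerivAt_eta1 hε w).continuousAt
lemma continuous_eta2 {ε : ℝ} (hε : 0 < ε) : Continuous (eta2 ε) := by
  unfold eta2
  have : ∀ w : ℝ, w^2+ε^2 ≠ 0 := fun w => (eta_pos hε w).ne'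
  have h2 : ∀ w : ℝ, 2 * √(w^2+ε^2) ≠ 0 := fun w =>
    mul_ne_zero two_ne_zero (Real.sqrt_pos.2 (eta_pos hε w)).ne'
  fun_prop (disch := assumption)

lemma exists_prim (g : ℝ → ℝ) (hg : Continuous g) :
    ∃ G : ℝ → ℝ, G 0 = 0 ∧ ∀ s, HasDerivAt G (g s) s :=
  ⟨fun s => ∫ r in (0:ℝ)..s, g r, by simp, fun s => hg.integral_hasStrictDerivAt 0 s |>.hasDerivAt⟩

lemma mv_bound {G g : ℝ → ℝ} (h : ∀ s, HasDerivAt G (g s) s) (a b C : ℝ)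
    (hb : ∀ s ∈ uIcc a b, |g s| ≤ C) : |G b - G a| ≤ C * |b - a| :=
  Convex.norm_image_sub_le_of_norm_hasDerivWithin_le
    (fun x _ => (h x).hasDerivWithinAt) hb (convex_uIcc a b) left_mem_uIcc right_mem_uIcc

structure Scal (p C : ℝ) (f T Th Q : ℝ → ℝ) : Prop where
  C0 : 0 ≤ C
  hf : ∀ s, HasDerivAt f (|s|^p) s
  hT : ∀ s, HasDerivAt T ((1+s^2)^(-(3/2-p))) s
  hTh : ∀ s, HasDerivAt Th (T s) s
  hQ : ∀ s, HasDerivAt Q (T s * |s|^p) s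
  fb : ∀ s, |f s| ≤ |s|^p * |s|
  fl : ∀ a b, |f a - f b| ≤ (|a|^p + |b|^p) * |a - b|
  Tb : ∀ s, |T s| ≤ C
  Thb : ∀ s, |Th s| ≤ C * |s|
  Thl : ∀ a b, |Th a - Th b| ≤ C * |a - b|
  Qb : ∀ s, |Q s| ≤ C * (|s|^p * |s|)

lemma abs_le_of_uIcc0 {s r : ℝ} (h : r ∈ uIcc 0 s) : |r| ≤ |s| := by
  rcases le_total 0 s with hs | hs
  · rw [uIcc_of_le hs] at h; rw [abs_of_nonneg h.1, abs_of_nonneg hs]; exact h.2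
  · rw [uIcc_of_ge hs] at h; rw [abs_of_nonpos h.2, abs_of_nonpos hs]; linarith [h.1]

lemma abs_le_of_uIcc {a b r : ℝ} (h : r ∈ uIcc a b) : |r| ≤ max |a| |b| := by
  rw [mem_uIcc] at h
  rcases h with h | h
  · exact abs_le_max_abs_abs h.1 h.2
  · rw [max_comm]; exact abs_le_max_abs_abs h.1 h.2

lemma exists_scal (p : ℝ) (hp0 : 0 < p) (hp1 : p < 1) : ∃ C f T Th Q, Scal p C f T Th Q := by
  have hcp : Continuous (fun s : ℝ => |s|^p) := by
    exact continuous_abs.rpow_const (fun _ => Or.inr hp0.le)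
  have hcg : Continuous (fun s : ℝ => (1+s^2)^(-(3/2-p))) := by
    apply Continuous.rpow_const (by fun_prop)
    intro x; left; positivity
  obtain ⟨f, f0, hf⟩ := exists_prim _ hcp
  have hIntg : Integrable (fun s : ℝ => (1+s^2)^(-(3/2-p))) := by
    have := integrable_rpow_neg_one_add_norm_sq (E := ℝ) (μ := volume) (r := 3 - 2*p)
      (by simp; linarith)
    convert this using 2 with s
    rw [Real.norm_eq_abs, sq_abs]; congr 1; ring
  set C := ∫ s : ℝ, (1+s^2)^(-(3/2-p))
  have hnn : ∀ s : ℝ, 0 ≤ (1+s^2)^(-(3/2-p)) := fun s => by positivity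
  have hC0 : 0 ≤ C := integral_nonneg hnn
  set T : ℝ → ℝ := fun s => ∫ r in (0:ℝ)..s, (1+r^2)^(-(3/2-p)) with hTdef
  have hT : ∀ s, HasDerivAt T ((1+s^2)^(-(3/2-p))) s := fun s =>
    (hcg.integral_hasStrictDerivAt 0 s).hasDerivAt
  have hTb : ∀ s, |T s| ≤ C := fun s => by
    simp only [hTdef]
    rw [← Real.norm_eq_abs]
    refine (intervalIntegral.norm_integral_le_integral_norm_uIoc).trans ?_
    simp_rw [fun r : ℝ => Real.norm_of_nonneg (hnn r)]
    exact setIntegral_le_integral hIntg (Eventually.of_forall hnn)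
  have hTc : Continuous T := continuous_iff_continuousAt.2 fun s => (hT s).continuousAt
  obtain ⟨Th, Th0, hTh⟩ := exists_prim T hTc
  obtain ⟨Q, Q0, hQ⟩ := exists_prim (fun s => T s * |s|^p) (hTc.mul hcp)
  have hThl : ∀ a b, |Th a - Th b| ≤ C * |a - b| := fun a b =>
    mv_bound hTh b a C (fun s _ => hTb s)
  have hpp : ∀ s r : ℝ, r ∈ uIcc 0 s → |r|^p ≤ |s|^p := fun s r h =>
    Real.rpow_le_rpow (abs_nonneg _) (abs_le_of_uIcc0 h) hp0.le
  refine ⟨C, f, T, Th, Q, hC0, hf, hT, hTh, hQ, ?_, ?_, hTb, ?_, hThl, ?_⟩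
  · intro s
    have := mv_bound hf 0 s (|s|^p) (fun r hr => by
      rw [abs_of_nonneg (by positivity)]; exact hpp s r hr)
    simpa [f0] using this
  · intro a b
    refine mv_bound hf b a _ (fun r hr => ?_)
    rw [abs_of_nonneg (by positivity)]
    have h1 : |r|^p ≤ (max |b| |a|)^p := Real.rpow_le_rpow (abs_nonneg _) (abs_le_of_uIcc hr) hp0.le
    refine h1.trans ?_
    have ha : 0 ≤ |a|^p := by positivity
    have hb : 0 ≤ |b|^p := by positivity
    rcases max_choice |b| |a| with h | h <;> rw [h] <;> linarith
  · intro s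
    simpa [Th0] using hThl s 0
  · intro s
    have := mv_bound hQ 0 s (C * |s|^p) (fun r hr => by
      rw [abs_mul, abs_of_nonneg (a := |r|^p) (by positivity)]
      exact mul_le_mul (hTb r) (hpp s r hr) (by positivity) hC0)
    simpa [Q0, mul_assoc] using this

end Perron


namespace Perron
open Set Topology

noncomputable def zt (R x : ℝ) : ℝ := 1 - x^2 / R^2
noncomputable def zt1 (R x : ℝ) : ℝ := - (2 * x) / R^2
noncomputable def rh (R x : ℝ) : ℝ := zt R x ^ 2
noncomputable def rh1 (R x : ℝ) : ℝ := 2 * zt R x * zt1 R x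
noncomputable def rh2 (R x : ℝ) : ℝ := 2 * zt1 R x ^ 2 - 4 * zt R x / R^2

lemma cont_zt (R : ℝ) : Continuous (zt R) := by unfold zt; fun_prop
lemma cont_zt1 (R : ℝ) : Continuous (zt1 R) := by unfold zt1; fun_prop
lemma cont_rh (R : ℝ) : Continuous (rh R) := by unfold rh; exact (cont_zt R).pow 2
lemma cont_rh1 (R : ℝ) : Continuous (rh1 R) := by
  unfold rh1; exact (continuous_const.mul (cont_zt R)).mul (cont_zt1 R)
lemma cont_rh2 (R : ℝ) : Continuous (rh2 R) := by
  unfold rh2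
  exact (continuous_const.mul ((cont_zt1 R).pow 2)).sub
    ((continuous_const.mul (cont_zt R)).div_const _)

lemma hasDerivAt_zt (R x : ℝ) : HasDerivAt (zt R) (zt1 R x) x := by
  have h := ((hasDerivAt_pow 2 x).div_const (R^2)).const_sub 1
  refine HasDerivAt.congr_deriv (f := zt R) h ?_
  unfold zt1; norm_num; ring

lemma hasDerivAt_zt1 (R x : ℝ) : HasDerivAt (zt1 R) (-2 / R^2) x := by
  have h := (((hasDerivAt_id' x).const_mul 2).neg).div_const (R^2)
  refine HasDerivAt.congr_deriv (f := zt1 R) h ?_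
  norm_num

lemma hasDerivAt_rh (R x : ℝ) : HasDerivAt (rh R) (rh1 R x) x := by
  have h := (hasDerivAt_zt R x).pow 2
  refine HasDerivAt.congr_deriv (f := rh R) h ?_
  unfold rh1; norm_num

lemma hasDerivAt_rh1 (R x : ℝ) : HasDerivAt (rh1 R) (rh2 R x) x := by
  have h := ((hasDerivAt_zt R x).const_mul 2).mul (hasDerivAt_zt1 R x)
  refine HasDerivAt.congr_deriv (f := rh1 R) h ?_
  unfold rh2; ring

section bounds
variable {R : ℝ} 

lemma zt_nonneg (hR : 0 < R) {x : ℝ} (hx : x ∈ Icc (-R) R) : 0 ≤ zt R x := by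
  have h : x^2 ≤ R^2 := by nlinarith [hx.1, hx.2]
  have : x^2 / R^2 ≤ 1 := by rw [div_le_one (by positivity)]; exact h
  unfold zt; linarith

lemma zt_le (x : ℝ) : zt R x ≤ 1 := by
  have : 0 ≤ x^2 / R^2 := by positivity
  unfold zt; linarith

lemma zt1_le (hR : 0 < R) {x : ℝ} (hx : x ∈ Icc (-R) R) : |zt1 R x| ≤ 2 / R := by
  unfold zt1
  rw [abs_div, abs_neg, abs_mul, abs_of_pos (show (0:ℝ) < 2 by norm_num), abs_of_pos (show 0 < R^2 by positivity),
    div_le_div_iff₀ (by positivity) hR]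
  have : |x| ≤ R := abs_le.2 hx
  nlinarith

lemma zt_R (hR : 0 < R) : zt R R = 0 := by unfold zt; field_simp; simp
lemma zt_nR (hR : 0 < R) : zt R (-R) = 0 := by unfold zt; field_simp; simp

lemma rh_nonneg (x : ℝ) : 0 ≤ rh R x := by unfold rh; positivity
lemma rh_le (hR : 0 < R) {x : ℝ} (hx : x ∈ Icc (-R) R) : rh R x ≤ 1 := by
  unfold rh; have := zt_nonneg hR hx; have := zt_le (R := R) x; nlinarith

lemma rh1_le (hR : 0 < R) {x : ℝ} (hx : x ∈ Icc (-R) R) : |rh1 R x| ≤ 4 / R * zt R x := by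
  unfold rh1
  have h0 := zt_nonneg hR hx
  rw [abs_mul, abs_mul, abs_of_nonneg h0, abs_of_pos (show (0:ℝ) < 2 by norm_num)]
  have := mul_le_mul_of_nonneg_left (zt1_le hR hx) (show 0 ≤ 2 * zt R x by positivity)
  refine this.trans (le_of_eq ?_); ring

lemma rh2_le (hR : 0 < R) {x : ℝ} (hx : x ∈ Icc (-R) R) : |rh2 R x| ≤ 12 / R^2 := by
  unfold rh2
  have h0 := zt_nonneg hR hx
  have h1 := zt_le (R := R) x
  have h2 : zt1 R x ^ 2 ≤ (2 / R)^2 := sq_le_sq' (by linarith [(abs_le.1 (zt1_le hR hx)).1]) (abs_le.1 (zt1_le hR hx)).2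
  have h3 : 4 * zt R x / R^2 ≤ 4 / R^2 := by gcongr; linarith
  have h4 : 0 ≤ 4 * zt R x / R^2 := by positivity
  have h5 : (2/R)^2 = 4 / R^2 := by rw [div_pow]; norm_num
  have h6 : 12 / R^2 = 3 * (4 / R^2) := by ring
  have h7 : 0 ≤ zt1 R x ^ 2 := sq_nonneg _
  rw [h5] at h2
  rw [h6]
  rw [abs_le]; constructor <;> linarith
end bounds

structure C2 (u u1 u2 : ℝ → ℝ) : Prop where
  h1 : ∀ x, HasDerivAt u (u1 x) x
  h2 : ∀ x, HasDerivAt u1 (u2 x) x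
  c2 : Continuous u2

lemma C2.c0 {u u1 u2 : ℝ → ℝ} (h : C2 u u1 u2) : Continuous u :=
  continuous_iff_continuousAt.2 fun x => (h.h1 x).continuousAt
lemma C2.c1 {u u1 u2 : ℝ → ℝ} (h : C2 u u1 u2) : Continuous u1 :=
  continuous_iff_continuousAt.2 fun x => (h.h2 x).continuousAt

lemma C2.cP {u u1 u2 : ℝ → ℝ} (h : C2 u u1 u2) (c : ℝ) : Continuous fun x => (1 + u x^2)^c := by
  have := h.c0
  apply Continuous.rpow_const (by fun_prop)
  intro x; left; positivity

lemma C2.cp {u u1 u2 : ℝ → ℝ} (h : C2 u u1 u2) {p : ℝ} (hp : 0 < p) : Continuous fun x => |u x|^p :=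
  h.c0.abs.rpow_const (fun _ => Or.inr hp.le)

lemma ftc_le {R : ℝ} (hR : 0 < R) {G g F h : ℝ → ℝ} (hG : ∀ x, HasDerivAt G (g x) x)
    (hg : Continuous g) (hF : Continuous F) (hh : Continuous h)
    (h1 : G R = 0) (h2 : G (-R) = 0) (hle : ∀ x ∈ Icc (-R) R, F x ≤ g x + h x) :
    ∫ x in -R..R, F x ≤ ∫ x in -R..R, h x := by
  have e : ∫ x in -R..R, g x = 0 := by
    rw [intervalIntegral.integral_eq_sub_of_hasDerivAt (fun x _ => hG x) (hg.intervalIntegrable _ _), h1, h2, sub_zero]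
  calc ∫ x in -R..R, F x ≤ ∫ x in -R..R, (g x + h x) :=
        intervalIntegral.integral_mono_on (by linarith) (hF.intervalIntegrable _ _)
          ((hg.add hh).intervalIntegrable _ _) hle
    _ = _ := by
        rw [intervalIntegral.integral_add (hg.intervalIntegrable _ _) (hh.intervalIntegrable _ _), e, zero_add]

noncomputable def DD (p R : ℝ) (u u1 : ℝ → ℝ) : ℝ :=
  ∫ x in -R..R, (1 + u x^2)^(-(3/2-p)) * u1 x^2 * rh R x

lemma rpow_bd {p : ℝ} (hp0 : 0 < p) (hp1 : p < 1) (a : ℝ) : (1 + a^2)^(p/2) ≤ 1 + |a| := by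
  have h1 : (1:ℝ) ≤ 1 + a^2 := by nlinarith [sq_nonneg a]
  calc (1 + a^2)^(p/2) ≤ (1+a^2)^((1:ℝ)/2) := Real.rpow_le_rpow_of_exponent_le h1 (by linarith)
    _ = √(1+a^2) := (Real.sqrt_eq_rpow _).symm
    _ ≤ 1 + |a| := by
      apply Real.sqrt_le_iff.2 ⟨by positivity, ?_⟩
      nlinarith [sq_abs a, abs_nonneg a]

lemma abs_rpow_bd {p : ℝ} (hp0 : 0 < p) (a : ℝ) : |a|^p ≤ (1 + a^2)^(p/2) := by
  have : |a|^p = (a^2)^(p/2) := by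
    rw [← sq_abs, ← Real.rpow_natCast, ← Real.rpow_mul (abs_nonneg _)]; congr 1; push_cast; ring
  rw [this]
  exact Real.rpow_le_rpow (sq_nonneg _) (by linarith) (by linarith)

lemma A1_pt {p : ℝ} (hp0 : 0 < p) (hp1 : p < 1) {δ : ℝ} (hδ : 0 < δ) (a a1 z z1 r : ℝ) (hz : 0 ≤ z)
    (hz1 : |z1| ≤ r) :
    (2 * a * a1) * (p/2) * (1 + a^2)^(p/2-1) * z + (1+a^2)^(p/2) * z1
     ≤ δ * ((1+a^2)^(-(3/2-p)) * a1^2 * z^2) + (1/(4*δ) + r) * (1 + |a|) := by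
  have h1 : (1:ℝ) ≤ 1 + a^2 := by nlinarith [sq_nonneg a]
  have h0 : (0:ℝ) < 1 + a^2 := by linarith
  set P := 1 + a^2
  have e2 : P^(p/2) * z1 ≤ r * (1 + |a|) := by
    have := rpow_bd hp0 hp1 a
    have h3 : 0 ≤ P^(p/2) := by positivity
    calc P^(p/2) * z1 ≤ P^(p/2) * r := by
          apply mul_le_mul_of_nonneg_left _ h3; exact (le_abs_self _).trans hz1
      _ ≤ (1+|a|) * r := mul_le_mul_of_nonneg_right this ((abs_nonneg _).trans hz1)
      _ = _ := mul_comm _ _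
  have ea : P^(-(3/2-p)) = (P^(-(3/4-p/2)))^2 := by
    rw [← Real.rpow_natCast, ← Real.rpow_mul h0.le]; congr 1; push_cast; ring
  have eb : (P^((1:ℝ)/4))^2 ≤ 1 + |a| := by
    rw [← Real.rpow_natCast, ← Real.rpow_mul h0.le]
    have : (1:ℝ)/4 * ((2:ℕ):ℝ) = 1/2 := by norm_num
    rw [this, ← Real.sqrt_eq_rpow]
    apply Real.sqrt_le_iff.2 ⟨by positivity, ?_⟩
    show 1 + a^2 ≤ _
    nlinarith [sq_abs a, abs_nonneg a]
  have ec : |a| * P^(p/2-1) ≤ P^(-(3/4-p/2)) * P^((1:ℝ)/4) := by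
    have : |a| ≤ P^((1:ℝ)/2) := by
      rw [← Real.sqrt_eq_rpow]; apply Real.abs_le_sqrt; show a^2 ≤ 1 + a^2; linarith
    calc |a| * P^(p/2-1) ≤ P^((1:ℝ)/2) * P^(p/2-1) := by gcongr
      _ = P^(-(3/4-p/2)) * P^((1:ℝ)/4) := by
        rw [← Real.rpow_add h0, ← Real.rpow_add h0]; congr 1; ring
  rw [ea]
  set A := P^(-(3/4-p/2)) with hA
  set B := P^((1:ℝ)/4) with hB
  have hA0 : 0 < A := by positivity
  have hB0 : 0 < B := by positivity
  have e1 : (2 * a * a1) * (p/2) * P^(p/2-1) * z ≤ (A * |a1| * z) * B := by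
    have hP0 : 0 < P^(p/2-1) := by positivity
    have s1 : (2 * a * a1) * (p/2) * P^(p/2-1) * z = p * (a * a1) * P^(p/2-1) * z := by ring
    have s2 : p * (a * a1) ≤ |a| * |a1| := by
      rw [← abs_mul]
      have := le_abs_self (a*a1); have := abs_nonneg (a*a1)
      nlinarith
    rw [s1]
    calc p * (a * a1) * P^(p/2-1) * z ≤ (|a| * |a1|) * P^(p/2-1) * z := by gcongr
      _ = (|a| * P^(p/2-1)) * (|a1| * z) := by ring
      _ ≤ (A * B) * (|a1| * z) := by gcongr
      _ = _ := by ring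
  have e3 : (A * |a1| * z) * B ≤ δ * (A^2 * a1^2 * z^2) + 1/(4*δ) * B^2 := by
    have : A^2 * a1^2 * z^2 = (A * |a1| * z)^2 := by rw [← sq_abs a1]; ring
    rw [this]
    set X := A * |a1| * z
    have : δ * X^2 + 1/(4*δ) * B^2 - X * B = δ * (X - B/(2*δ))^2 := by field_simp; ring
    have : 0 ≤ δ * (X - B/(2*δ))^2 := by positivity
    linarith
  have e4 : 1/(4*δ) * B^2 ≤ 1/(4*δ) * (1+|a|) := by gcongr
  linarith

lemma A1 {p : ℝ} (hp0 : 0 < p) (hp1 : p < 1) {R : ℝ} (hR : 0 < R) {u u1 u2 : ℝ → ℝ} (h : C2 u u1 u2)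
    {m : ℝ} (hm : ∫ x in -R..R, |u x| ≤ m) {δ : ℝ} (hδ : 0 < δ) {x : ℝ} (hx : x ∈ Icc (-R) R) :
    (1 + u x^2)^(p/2) * zt R x ≤ δ * DD p R u u1 + (1/(4*δ) + 2/R) * (2*R+m) := by
  have c0 := h.c0
  have c1 := h.c1
  have cz := cont_zt R
  have cz1 := cont_zt1 R
  have cr := cont_rh R
  have cP1 := h.cP (p/2)
  have cP2 := h.cP (p/2-1)
  have cP3 := h.cP (-(3/2-p))
  set g : ℝ → ℝ := fun y => (1 + u y^2)^(p/2) * zt R y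
  set g' : ℝ → ℝ := fun y => (2 * u y * u1 y) * (p/2) * (1 + u y^2)^(p/2-1) * zt R y + (1+u y^2)^(p/2) * zt1 R y
  set F : ℝ → ℝ := fun y => δ * ((1+u y^2)^(-(3/2-p)) * u1 y^2 * rh R y) + (1/(4*δ) + 2/R) * (1 + |u y|)
  have hg : ∀ y, HasDerivAt g (g' y) y := fun y => by
    have h1 := (((h.h1 y).pow 2).const_add 1).rpow_const (p := p/2) (Or.inl (by
      have : 0 < 1 + u y^2 := by positivity
      simpa using this.ne'))
    have h2 := h1.mul (hasDerivAt_zt R y)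
    refine HasDerivAt.congr_deriv (f := g) h2 ?_
    simp [g']
  have hg'c : Continuous g' := by fun_prop
  have hFc : Continuous F := by fun_prop
  have hF0 : ∀ y, 0 ≤ F y := fun y => by
    have := rh_nonneg (R := R) y
    simp only [F]; positivity
  have hle : ∀ y ∈ Icc (-R) R, g' y ≤ F y := fun y hy =>
    A1_pt hp0 hp1 hδ (u y) (u1 y) (zt R y) (zt1 R y) (2/R) (zt_nonneg hR hy) (zt1_le hR hy)
  have e : ∫ y in -R..x, g' y = g x := by
    rw [intervalIntegral.integral_eq_sub_of_hasDerivAt (fun x _ => hg x) (hg'c.intervalIntegrable _ _)]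
    simp [g, zt_nR hR]
  have e2 : ∫ y in -R..x, g' y ≤ ∫ y in -R..x, F y :=
    intervalIntegral.integral_mono_on hx.1 (hg'c.intervalIntegrable _ _) (hFc.intervalIntegrable _ _)
      fun y hy => hle y ⟨hy.1, hy.2.trans hx.2⟩
  have e3 : ∫ y in -R..x, F y ≤ ∫ y in -R..R, F y := 
    intervalIntegral.integral_mono_interval le_rfl hx.1 hx.2 (Eventually.of_forall hF0) (hFc.intervalIntegrable _ _)
  have e4 : ∫ y in -R..R, F y = δ * DD p R u u1 + (1/(4*δ) + 2/R) * (2*R + ∫ x in -R..R, |u x|) := by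
    simp only [F, DD]
    rw [intervalIntegral.integral_add (Continuous.intervalIntegrable (by fun_prop) _ _) (Continuous.intervalIntegrable (by fun_prop) _ _),
      intervalIntegral.integral_const_mul, intervalIntegral.integral_const_mul,
      intervalIntegral.integral_add (Continuous.intervalIntegrable (by fun_prop) _ _) (Continuous.intervalIntegrable (by fun_prop) _ _)]
    simp; left; ring
  have e5 : (1/(4*δ) + 2/R) * (2*R + ∫ x in -R..R, |u x|) ≤ (1/(4*δ) + 2/R) * (2*R+m) := by gcongr
  change g x ≤ _
  linarith

end Perron


namespace Perron
open Set Topology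

/-- viscous part -/
noncomputable def UU (p μ : ℝ) (u u1 u2 : ℝ → ℝ) (x : ℝ) : ℝ := -(|u x|^p * u1 x) + μ * u2 x

lemma C2.cU {u u1 u2 : ℝ → ℝ} (h : C2 u u1 u2) {p : ℝ} (hp : 0 < p) (μ : ℝ) :
    Continuous (UU p μ u u1 u2) := by
  have := h.cp hp; have := h.c1; have := h.c2
  unfold UU; fun_prop

lemma Scal.cf {p C : ℝ} {f T Th Q : ℝ → ℝ} (h : Scal p C f T Th Q) : Continuous f :=
  continuous_iff_continuousAt.2 fun x => (h.hf x).continuousAt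
lemma Scal.cT {p C : ℝ} {f T Th Q : ℝ → ℝ} (h : Scal p C f T Th Q) : Continuous T :=
  continuous_iff_continuousAt.2 fun x => (h.hT x).continuousAt
lemma Scal.cTh {p C : ℝ} {f T Th Q : ℝ → ℝ} (h : Scal p C f T Th Q) : Continuous Th :=
  continuous_iff_continuousAt.2 fun x => (h.hTh x).continuousAt
lemma Scal.cQ {p C : ℝ} {f T Th Q : ℝ → ℝ} (h : Scal p C f T Th Q) : Continuous Q :=
  continuous_iff_continuousAt.2 fun x => (h.hQ x).continuousAt

lemma A2 {p : ℝ} (hp0 : 0 < p) {C : ℝ} {f T Th Q : ℝ → ℝ} (hS : Scal p C f T Th Q)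
    {μ : ℝ} (hμ : 0 < μ) {R : ℝ} (hR : 0 < R) {u u1 u2 : ℝ → ℝ} (h : C2 u u1 u2)
    {m : ℝ} (hm : ∫ x in -R..R, |u x| ≤ m) {s : ℝ} (hs0 : 0 ≤ s)
    (hs : ∀ x ∈ Icc (-R) R, |u x|^p * zt R x ≤ s) :
    ∫ x in -R..R, T (u x) * UU p μ u u1 u2 x * rh R x
      ≤ -(μ * DD p R u u1) + 4/R*C*s*m + 12*μ*C*m/R^2 := by
  have c0 := h.c0
  have c1 := h.c1
  have c2 := h.c2
  have cz := cont_zt R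
  have cr := cont_rh R
  have cr1 := cont_rh1 R
  have cr2 := cont_rh2 R
  have cP3 := h.cP (-(3/2-p))
  have cp := h.cp hp0
  have cT := hS.cT.comp c0
  have cTh := hS.cTh.comp c0
  have cQ := hS.cQ.comp c0
  have cU := h.cU hp0 μ
  have C0 := hS.C0
  simp only [Function.comp_def] at cT cTh cQ
  set G : ℝ → ℝ := fun x => -(Q (u x) * rh R x) + μ * (T (u x) * u1 x * rh R x) - μ * (Th (u x) * rh1 R x)
  set g : ℝ → ℝ := fun x => -((T (u x) * |u x|^p) * u1 x * rh R x + Q (u x) * rh1 R x)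
    + μ * (((1+u x^2)^(-(3/2-p)) * u1 x * u1 x + T (u x) * u2 x) * rh R x + T (u x) * u1 x * rh1 R x)
    - μ * (T (u x) * u1 x * rh1 R x + Th (u x) * rh2 R x)
  have hG : ∀ x, HasDerivAt G (g x) x := fun x => by
    have hr := hasDerivAt_rh R x
    have hr1 := hasDerivAt_rh1 R x
    have hQ := (hS.hQ (u x)).comp x (h.h1 x)
    have hT := (hS.hT (u x)).comp x (h.h1 x)
    have hTh := (hS.hTh (u x)).comp x (h.h1 x)
    exact ((hQ.mul hr).neg.add (((hT.mul (h.h2 x)).mul hr).const_mul μ)).sub ((hTh.mul hr1).const_mul μ)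
  have key := ftc_le hR (F := fun x => T (u x) * UU p μ u u1 u2 x * rh R x)
    (h := fun x => -μ * ((1 + u x^2)^(-(3/2-p)) * u1 x^2 * rh R x) + (4/R*C*s + 12*μ*C/R^2) * |u x|)
    hG (by
      have := hS.cT; have := hS.cTh; have := hS.cQ
      simp only [g]; fun_prop) ((cT.mul cU).mul cr) (by fun_prop)
    (by simp [G, rh, rh1, zt_R hR]) (by simp [G, rh, rh1, zt_nR hR]) (by
      intro x hx
      have b1 : Q (u x) * rh1 R x ≤ 4/R*C*s*|u x| := by
        have hz := zt_nonneg hR hx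
        calc Q (u x) * rh1 R x ≤ |Q (u x)| * |rh1 R x| := by rw [← abs_mul]; exact le_abs_self _
          _ ≤ (C * (|u x|^p * |u x|)) * (4/R * zt R x) := by
            apply mul_le_mul (hS.Qb _) (rh1_le hR hx) (abs_nonneg _) (by positivity)
          _ = 4/R*C*|u x| * (|u x|^p * zt R x) := by ring
          _ ≤ 4/R*C*|u x| * s := by
            apply mul_le_mul_of_nonneg_left (hs x hx) (by positivity)
          _ = _ := by ring
      have b2 : Th (u x) * rh2 R x ≤ 12*C/R^2 * |u x| := by
        calc Th (u x) * rh2 R x ≤ |Th (u x)| * |rh2 R x| := by rw [← abs_mul]; exact le_abs_self _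
          _ ≤ (C * |u x|) * (12/R^2) := by
            apply mul_le_mul (hS.Thb _) (rh2_le hR hx) (abs_nonneg _) (by positivity)
          _ = _ := by ring
      have b3 := mul_le_mul_of_nonneg_left b2 hμ.le
      have : T (u x) * UU p μ u u1 u2 x * rh R x = g x + (-μ * ((1 + u x^2)^(-(3/2-p)) * u1 x^2 * rh R x))
         + Q (u x) * rh1 R x + μ * (Th (u x) * rh2 R x) := by simp only [g, UU]; ring
      rw [this]
      have e : (4/R*C*s + 12*μ*C/R^2) * |u x| = 4/R*C*s*|u x| + μ * (12*C/R^2 * |u x|) := by ring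
      rw [e]; linarith)
  refine key.trans ?_
  rw [intervalIntegral.integral_add (Continuous.intervalIntegrable (by fun_prop) _ _) (Continuous.intervalIntegrable (by fun_prop) _ _),
      intervalIntegral.integral_const_mul, intervalIntegral.integral_const_mul]
  have : (4/R*C*s + 12*μ*C/R^2) * (∫ x in -R..R, |u x|) ≤ (4/R*C*s + 12*μ*C/R^2) * m := by gcongr
  have e : (4/R*C*s + 12*μ*C/R^2) * m = 4/R*C*s*m + 12*μ*C*m/R^2 := by ring
  unfold DD; linarith

lemma A3 {p : ℝ} (hp0 : 0 < p) (hp1 : p < 1) {C : ℝ} {f T Th Q : ℝ → ℝ} (hS : Scal p C f T Th Q)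
    {μ : ℝ} (hμ : 0 < μ) {R : ℝ} (hR : 0 < R) {ε : ℝ} (hε : 0 < ε) {a a1 a2 b b1 b2 : ℝ → ℝ}
    (ha : C2 a a1 a2) (hb : C2 b b1 b2)
    {m : ℝ} (hma : ∫ x in -R..R, |a x| ≤ m) (hmb : ∫ x in -R..R, |b x| ≤ m)
    {s t : ℝ} (hs0 : 0 ≤ s) (ht0 : 0 ≤ t)
    (hs : ∀ x ∈ Icc (-R) R, |a x|^p * zt R x ≤ s) (ht : ∀ x ∈ Icc (-R) R, |b x|^p * zt R x ≤ t) :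
    ∫ x in -R..R, eta1 ε (a x - b x) * (UU p μ a a1 a2 x - UU p μ b b1 b2 x) * rh R x
      ≤ ε/(4*μ)*(s+t)*(2*R+m) + 4/R*(s+t)*m + 12*μ/R^2*(2*m+2*R*ε) := by
  have ca0 := ha.c0
  have ca1 := ha.c1
  have ca2 := ha.c2
  have cb0 := hb.c0
  have cb1 := hb.c1
  have cb2 := hb.c2
  have cz := cont_zt R
  have cr := cont_rh R
  have cr1 := cont_rh1 R
  have cr2 := cont_rh2 R
  have cap := ha.cp hp0
  have cbp := hb.cp hp0
  have cUa := ha.cU hp0 μ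
  have cUb := hb.cU hp0 μ
  have cfa := hS.cf.comp ca0
  have cfb := hS.cf.comp cb0
  have ce := (continuous_eta ε).comp (ca0.sub cb0)
  have ce1 := (continuous_eta1 hε).comp (ca0.sub cb0)
  have ce2 := (continuous_eta2 hε).comp (ca0.sub cb0)
  simp only [Function.comp_def] at cfa cfb ce ce1 ce2
  set w : ℝ → ℝ := fun x => a x - b x
  have hw : ∀ x, HasDerivAt w (a1 x - b1 x) x := fun x => (ha.h1 x).sub (hb.h1 x)
  set G : ℝ → ℝ := fun x => -(eta1 ε (w x) * (f (a x) - f (b x)) * rh R x)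
     + μ * (eta1 ε (w x) * (a1 x - b1 x) * rh R x) - μ * (eta ε (w x) * rh1 R x)
  set g : ℝ → ℝ := fun x => 
    -((eta2 ε (w x) * (a1 x - b1 x) * (f (a x) - f (b x)) + eta1 ε (w x) * (|a x|^p * a1 x - |b x|^p * b1 x)) * rh R x
        + eta1 ε (w x) * (f (a x) - f (b x)) * rh1 R x)
    + μ * ((eta2 ε (w x) * (a1 x - b1 x) * (a1 x - b1 x) + eta1 ε (w x) * (a2 x - b2 x)) * rh R x + eta1 ε (w x) * (a1 x - b1 x) * rh1 R x)
    - μ * (eta1 ε (w x) * (a1 x - b1 x) * rh1 R x + eta ε (w x) * rh2 R x)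
  have hG : ∀ x, HasDerivAt G (g x) x := fun x => by
    have hr := hasDerivAt_rh R x
    have hr1 := hasDerivAt_rh1 R x
    have hfa := (hS.hf (a x)).comp x (ha.h1 x)
    have hfb := (hS.hf (b x)).comp x (hb.h1 x)
    have h1 := (hasDerivAt_eta1 hε (w x)).comp x (hw x)
    have h0 := (hasDerivAt_eta hε (w x)).comp x (hw x)
    exact (((h1.mul (hfa.sub hfb)).mul hr).neg.add
      (((h1.mul ((ha.h2 x).sub (hb.h2 x))).mul hr).const_mul μ)).sub ((h0.mul hr1).const_mul μ)
  have hcw : Continuous w := ca0.sub cb0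
  have key := ftc_le hR (F := fun x => eta1 ε (w x) * (UU p μ a a1 a2 x - UU p μ b b1 b2 x) * rh R x)
    (h := fun x => (ε/(4*μ)*(s+t) + 12*μ/R^2*ε) + (ε/(4*μ)*s + 4/R*s + 12*μ/R^2) * |a x|
       + (ε/(4*μ)*t + 4/R*t + 12*μ/R^2) * |b x|)
    hG (by
      have := hS.cf; have := continuous_eta ε; have := continuous_eta1 hε; have := continuous_eta2 hε
      simp only [g]; fun_prop) ((ce1.mul (cUa.sub cUb)).mul cr) (by fun_prop)
    (by simp [G, rh, rh1, zt_R hR]) (by simp [G, rh, rh1, zt_nR hR]) (by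
      intro x hx
      have hz := zt_nonneg hR hx
      have hz1 := zt_le (R := R) x
      have hsx := hs x hx
      have htx := ht x hx
      have n1 := eta1_nonneg hε (w x)
      have n1' := eta1_le hε (w x)
      have n2 := eta2_nonneg hε (w x)
      have b1' : eta1 ε (w x) * (f (a x) - f (b x)) * rh1 R x ≤ 4/R*s*|a x| + 4/R*t*|b x| := by
        calc eta1 ε (w x) * (f (a x) - f (b x)) * rh1 R x
            ≤ |eta1 ε (w x) * (f (a x) - f (b x)) * rh1 R x| := le_abs_self _
          _ = eta1 ε (w x) * |f (a x) - f (b x)| * |rh1 R x| := by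
            rw [abs_mul, abs_mul, abs_of_nonneg n1]
          _ ≤ 1 * (|a x|^p * |a x| + |b x|^p * |b x|) * (4/R * zt R x) := by
            gcongr
            · exact (abs_sub _ _).trans (add_le_add (hS.fb _) (hS.fb _))
            · exact rh1_le hR hx
          _ = 4/R*|a x| * (|a x|^p * zt R x) + 4/R*|b x| * (|b x|^p * zt R x) := by ring
          _ ≤ 4/R*|a x| * s + 4/R*|b x| * t := by gcongr
          _ = _ := by ring
      have b2' : eta ε (w x) * rh2 R x ≤ (|a x| + |b x| + ε) * (12/R^2) := by
        have e0 : 0 ≤ eta ε (w x) := (le_max_right _ _).trans (le_eta hε _)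
        calc eta ε (w x) * rh2 R x ≤ eta ε (w x) * (12/R^2) := by
              gcongr; exact (le_abs_self _).trans (rh2_le hR hx)
          _ ≤ _ := by
              gcongr
              have := eta_le_abs hε (w x)
              have : |w x| ≤ |a x| + |b x| := abs_sub _ _
              linarith
      have b2'' := mul_le_mul_of_nonneg_left b2' hμ.le
      have sq1 : ∀ c r : ℝ, |c|^p * zt R x ≤ r → (|c|^p)^2 * rh R x ≤ r * (1 + |c|) := by
        intro c r hc
        have q1 := (abs_rpow_bd hp0 c).trans (rpow_bd hp0 hp1 c)
        have q0 : 0 ≤ |c|^p := by positivity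
        calc (|c|^p)^2 * rh R x = (|c|^p * zt R x) * (|c|^p * zt R x) := by unfold rh; ring
          _ ≤ r * ((1+|c|) * 1) := by
            apply mul_le_mul hc _ (by positivity) ((by positivity : 0 ≤ |c|^p * zt R x).trans hc)
            apply mul_le_mul q1 hz1 hz (by positivity)
          _ = _ := by ring
      have b3 : eta2 ε (w x) * (f (a x) - f (b x))^2 * rh R x ≤ ε * (s * (1+|a x|) + t * (1+|b x|)) := by
        have r0 := rh_nonneg (R := R) x
        have l1 : (f (a x) - f (b x))^2 ≤ ((|a x|^p + |b x|^p) * |w x|)^2 := by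
          rw [← sq_abs (f (a x) - f (b x))]
          exact pow_le_pow_left₀ (abs_nonneg _) (hS.fl _ _) 2
        calc eta2 ε (w x) * (f (a x) - f (b x))^2 * rh R x
            ≤ eta2 ε (w x) * ((|a x|^p + |b x|^p) * |w x|)^2 * rh R x := by gcongr
          _ = (eta2 ε (w x) * (w x)^2) * ((|a x|^p + |b x|^p)^2 * rh R x) := by rw [← sq_abs (w x)]; ring
          _ ≤ ε/2 * ((|a x|^p + |b x|^p)^2 * rh R x) := by
            gcongr; exact eta2_mul hε _
          _ ≤ ε/2 * ((2 * (|a x|^p)^2 + 2 * (|b x|^p)^2) * rh R x) := by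
            gcongr; nlinarith [sq_nonneg (|a x|^p - |b x|^p)]
          _ = ε * ((|a x|^p)^2 * rh R x + (|b x|^p)^2 * rh R x) := by ring
          _ ≤ _ := by
            apply mul_le_mul_of_nonneg_left _ hε.le
            exact add_le_add (sq1 _ _ hsx) (sq1 _ _ htx)
      have b4 : (eta2 ε (w x) * ((a1 x - b1 x) * (f (a x) - f (b x)) - μ * (a1 x - b1 x)^2)) * rh R x
           ≤ 1/(4*μ) * (eta2 ε (w x) * (f (a x) - f (b x))^2 * rh R x) := by
        have r0 := rh_nonneg (R := R) x
        set X := a1 x - b1 x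
        set Y := f (a x) - f (b x)
        have : X * Y - μ * X^2 ≤ 1/(4*μ) * Y^2 := by
          have e : 1/(4*μ) * Y^2 - (X * Y - μ * X^2) = μ * (X - Y/(2*μ))^2 := by field_simp; ring
          have : 0 ≤ μ * (X - Y/(2*μ))^2 := by positivity
          linarith
        calc _ ≤ (eta2 ε (w x) * (1/(4*μ) * Y^2)) * rh R x := by gcongr
          _ = _ := by ring
      have b5 := mul_le_mul_of_nonneg_left b3 (show 0 ≤ 1/(4*μ) by positivity)
      have : eta1 ε (w x) * (UU p μ a a1 a2 x - UU p μ b b1 b2 x) * rh R x = g x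
         + (eta2 ε (w x) * ((a1 x - b1 x) * (f (a x) - f (b x)) - μ * (a1 x - b1 x)^2)) * rh R x
         + eta1 ε (w x) * (f (a x) - f (b x)) * rh1 R x + μ * (eta ε (w x) * rh2 R x) := by
        simp only [g, UU]; ring
      rw [this]
      have e : (ε/(4*μ)*(s+t) + 12*μ/R^2*ε) + (ε/(4*μ)*s + 4/R*s + 12*μ/R^2) * |a x|
         + (ε/(4*μ)*t + 4/R*t + 12*μ/R^2) * |b x| = 1/(4*μ) * (ε * (s * (1+|a x|) + t * (1+|b x|)))
         + (4/R*s*|a x| + 4/R*t*|b x|) + μ * ((|a x| + |b x| + ε) * (12/R^2)) := by ring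
      rw [e]; linarith)
  refine key.trans ?_
  rw [intervalIntegral.integral_add (Continuous.intervalIntegrable (by fun_prop) _ _) (Continuous.intervalIntegrable (by fun_prop) _ _),
      intervalIntegral.integral_add (Continuous.intervalIntegrable (by fun_prop) _ _) (Continuous.intervalIntegrable (by fun_prop) _ _),
      intervalIntegral.integral_const_mul, intervalIntegral.integral_const_mul, intervalIntegral.integral_const]
  have k1 : (ε/(4*μ)*s + 4/R*s + 12*μ/R^2) * (∫ x in -R..R, |a x|) ≤ (ε/(4*μ)*s + 4/R*s + 12*μ/R^2) * m := by gcongr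
  have k2 : (ε/(4*μ)*t + 4/R*t + 12*μ/R^2) * (∫ x in -R..R, |b x|) ≤ (ε/(4*μ)*t + 4/R*t + 12*μ/R^2) * m := by gcongr
  simp only [smul_eq_mul]
  have e : ε/(4*μ)*(s+t)*(2*R+m) + 4/R*(s+t)*m + 12*μ/R^2*(2*m+2*R*ε)
    = (R - -R) * (ε/(4*μ)*(s+t) + 12*μ/R^2*ε) + (ε/(4*μ)*s + 4/R*s + 12*μ/R^2) * m
      + (ε/(4*μ)*t + 4/R*t + 12*μ/R^2) * m := by ring
  rw [e]; linarith

noncomputable def KK (μ R m ε κ C : ℝ) : ℝ := ε/(4*μ)*(2*R+m) + 4/R*m*(1+κ*C)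
noncomputable def Lam (μ R m ε κ C : ℝ) : ℝ :=
  2*KK μ R m ε κ C*(KK μ R m ε κ C/(4*κ*μ) + 2/R)*(2*R+m)
   + 12*μ/R^2*(2*m+2*R*ε) + 24*κ*μ*C*m/R^2

lemma A4 {p : ℝ} (hp0 : 0 < p) (hp1 : p < 1) {C : ℝ} {f T Th Q : ℝ → ℝ} (hS : Scal p C f T Th Q)
    {μ : ℝ} (hμ : 0 < μ) {R : ℝ} (hR : 0 < R) {ε : ℝ} (hε : 0 < ε) {κ : ℝ} (hκ : 0 < κ)
    {a a1 a2 b b1 b2 : ℝ → ℝ} (ha : C2 a a1 a2) (hb : C2 b b1 b2)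
    {m : ℝ} (hma : ∫ x in -R..R, |a x| ≤ m) (hmb : ∫ x in -R..R, |b x| ≤ m) :
    (∫ x in -R..R, eta1 ε (a x - b x) * (UU p μ a a1 a2 x - UU p μ b b1 b2 x) * rh R x)
     + κ * (∫ x in -R..R, T (a x) * UU p μ a a1 a2 x * rh R x)
     + κ * (∫ x in -R..R, T (b x) * UU p μ b b1 b2 x * rh R x) ≤ Lam μ R m ε κ C := by
  have hm : 0 ≤ m := le_trans (intervalIntegral.integral_nonneg (by linarith) (fun _ _ => abs_nonneg _)) hma
  have C0 := hS.C0
  set K := KK μ R m ε κ C with hK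
  have hK0 : 0 < K := by
    rw [hK]; unfold KK; positivity
  set δ := κ*μ/K
  have hδ : 0 < δ := by positivity
  have hDD : ∀ v v1 : ℝ → ℝ, 0 ≤ DD p R v v1 := fun v v1 => by
    unfold DD
    apply intervalIntegral.integral_nonneg (by linarith)
    intro x _; have := rh_nonneg (R := R) x; positivity
  set s := δ * DD p R a a1 + (1/(4*δ) + 2/R) * (2*R+m)
  set t := δ * DD p R b b1 + (1/(4*δ) + 2/R) * (2*R+m)
  have hs0 : 0 ≤ s := by have := hDD a a1; positivity
  have ht0 : 0 ≤ t := by have := hDD b b1; positivity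
  have hs : ∀ x ∈ Icc (-R) R, |a x|^p * zt R x ≤ s := fun x hx =>
    (mul_le_mul_of_nonneg_right (abs_rpow_bd hp0 _) (zt_nonneg hR hx)).trans (A1 hp0 hp1 hR ha hma hδ hx)
  have ht : ∀ x ∈ Icc (-R) R, |b x|^p * zt R x ≤ t := fun x hx =>
    (mul_le_mul_of_nonneg_right (abs_rpow_bd hp0 _) (zt_nonneg hR hx)).trans (A1 hp0 hp1 hR hb hmb hδ hx)
  have k1 := A3 hp0 hp1 hS hμ hR hε ha hb hma hmb hs0 ht0 hs ht
  have k2 := mul_le_mul_of_nonneg_left (A2 hp0 hS hμ hR ha hma hs0 hs) hκ.le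
  have k3 := mul_le_mul_of_nonneg_left (A2 hp0 hS hμ hR hb hmb ht0 ht) hκ.le
  have e1 : ε/(4*μ)*(s+t)*(2*R+m) + 4/R*(s+t)*m + 12*μ/R^2*(2*m+2*R*ε)
     + κ * (-(μ * DD p R a a1) + 4/R*C*s*m + 12*μ*C*m/R^2) 
     + κ * (-(μ * DD p R b b1) + 4/R*C*t*m + 12*μ*C*m/R^2) 
     = K * (s+t) - κ*μ*(DD p R a a1 + DD p R b b1) + 12*μ/R^2*(2*m+2*R*ε) + 24*κ*μ*C*m/R^2 := by
    rw [hK]; unfold KK; ring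
  have e2 : K * (s+t) - κ*μ*(DD p R a a1 + DD p R b b1) = 2*K*(K/(4*κ*μ) + 2/R)*(2*R+m) := by
    have d1 : K * δ = κ*μ := by simp only [δ]; field_simp
    have d2 : 1/(4*δ) = K/(4*κ*μ) := by simp only [δ]; field_simp
    simp only [s, t]
    rw [← d1, d2]; ring
  unfold Lam
  rw [← hK]
  linarith

end Perron


namespace Perron
open Set Topology

def Bd (R k : ℝ) (w : ℝ → ℝ) : Prop :=
  (∀ x ∈ Icc (-R) R, |w x| ≤ k) ∧ (∀ x ∈ Icc (-R) R, ∀ y ∈ Icc (-R) R, |w x - w y| ≤ k * |x - y|) ∧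
  ConvexOn ℝ (Icc (-R) R) (fun x => k/2*x^2 + w x) ∧
  ConvexOn ℝ (Icc (-R) R) (fun x => k/2*x^2 + - w x)

lemma C2.neg {u u1 u2 : ℝ → ℝ} (h : C2 u u1 u2) :
    C2 (fun x => - u x) (fun x => - u1 x) (fun x => - u2 x) :=
  ⟨fun x => (h.h1 x).neg, fun x => (h.h2 x).neg, h.c2.neg⟩

lemma convexOn_lim {s : Set ℝ} {F : ℕ → ℝ → ℝ} {f : ℝ → ℝ} (h : ∀ n, ConvexOn ℝ s (F n))
    (hl : ∀ x, Tendsto (fun n => F n x) atTop (𝓝 (f x))) : ConvexOn ℝ s f := by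
  refine ⟨(h 0).1, ?_⟩
  intro x hx y hy a b ha hb hab
  exact le_of_tendsto_of_tendsto' (hl _) (((hl x).const_smul a).add ((hl y).const_smul b))
    (fun n => (h n).2 hx hy ha hb hab)

lemma Bd_lim {R k : ℝ} {F : ℕ → ℝ → ℝ} {f : ℝ → ℝ} (h : ∀ n, Bd R k (F n))
    (hl : ∀ x, Tendsto (fun n => F n x) atTop (𝓝 (f x))) : Bd R k f := by
  refine ⟨?_, ?_, ?_, ?_⟩
  · intro x hx
    exact le_of_tendsto' (hl x).abs (fun n => (h n).1 x hx)
  · intro x hx y hy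
    exact le_of_tendsto' ((hl x).sub (hl y)).abs (fun n => (h n).2.1 x hx y hy)
  · exact convexOn_lim (fun n => (h n).2.2.1) (fun x => (hl x).const_add _)
  · exact convexOn_lim (fun n => (h n).2.2.2) (fun x => (hl x).neg.const_add _)

lemma C2.cvx {u u1 u2 : ℝ → ℝ} (h : C2 u u1 u2) {R k : ℝ} (hk : ∀ x ∈ Icc (-R) R, |u2 x| ≤ k) :
    ConvexOn ℝ (Icc (-R) R) (fun x => k/2*x^2 + u x) := by
  have hd : ∀ x, HasDerivAt (fun x => k/2*x^2 + u x) (k * x + u1 x) x := fun x => by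
    refine (((hasDerivAt_pow 2 x).const_mul (k/2)).add (h.h1 x)).congr_deriv ?_
    norm_num; ring
  have hd2 : ∀ x, HasDerivAt (fun x => k * x + u1 x) (k + u2 x) x := fun x => by
    refine (((hasDerivAt_id' x).const_mul k).add (h.h2 x)).congr_deriv ?_
    ring
  apply convexOn_of_hasDerivWithinAt2_nonneg (convex_Icc _ _)
    (f' := fun x => k * x + u1 x) (f'' := fun x => k + u2 x)
  · exact fun x _ => (hd x).continuousAt.continuousWithinAt
  · exact fun x _ => (hd x).hasDerivWithinAt
  · exact fun x _ => (hd2 x).hasDerivWithinAt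
  · intro x hx
    have := (abs_le.1 (hk x (interior_subset hx))).1
    linarith

lemma C2.of_cvx {u u1 u2 : ℝ → ℝ} (h : C2 u u1 u2) {R k : ℝ}
    (hc : ConvexOn ℝ (Icc (-R) R) (fun x => k/2*x^2 + u x)) {x : ℝ} (hx : x ∈ Ioo (-R) R) : -k ≤ u2 x := by
  have hd : ∀ x, HasDerivAt (fun x => k/2*x^2 + u x) (k * x + u1 x) x := fun x => by
    refine (((hasDerivAt_pow 2 x).const_mul (k/2)).add (h.h1 x)).congr_deriv ?_
    norm_num; ring
  have hd2 : ∀ x, HasDerivAt (fun x => k * x + u1 x) (k + u2 x) x := fun x => by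
    refine (((hasDerivAt_id' x).const_mul k).add (h.h2 x)).congr_deriv ?_
    ring
  have hm := hc.monotoneOn_deriv (fun x _ => (hd x).differentiableAt)
  have e : deriv (fun x => k/2*x^2 + u x) = fun x => k * x + u1 x := funext fun x => (hd x).deriv
  rw [e] at hm
  have := (hm.mono Ioo_subset_Icc_self).derivWithin_nonneg (x := x)
  rw [((hd2 x).hasDerivWithinAt).derivWithin (isOpen_Ioo.uniqueDiffWithinAt hx)] at this
  linarith

lemma C2.exists_Bd {u u1 u2 : ℝ → ℝ} (h : C2 u u1 u2) (R : ℝ) : ∃ k0, ∀ k ≥ k0, Bd R k u := by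
  obtain ⟨A, hA⟩ := isCompact_Icc.exists_bound_of_continuousOn (s := Icc (-R) R) h.c0.continuousOn
  obtain ⟨B, hB⟩ := isCompact_Icc.exists_bound_of_continuousOn (s := Icc (-R) R) h.c1.continuousOn
  obtain ⟨D, hD⟩ := isCompact_Icc.exists_bound_of_continuousOn (s := Icc (-R) R) h.c2.continuousOn
  refine ⟨max A (max B D), fun k hk => ?_⟩
  have k1 : A ≤ k := (le_max_left _ _).trans hk
  have k2 : B ≤ k := ((le_max_left _ _).trans (le_max_right _ _)).trans hk
  have k3 : D ≤ k := ((le_max_right _ _).trans (le_max_right _ _)).trans hk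
  refine ⟨fun x hx => (hA x hx).trans k1, ?_, h.cvx (fun x hx => (hD x hx).trans k3),
    h.neg.cvx (fun x hx => by rw [abs_neg]; exact (hD x hx).trans k3)⟩
  intro x hx y hy
  exact mv_bound h.h1 y x k (fun s hs => (hB s ((uIcc_subset_Icc hy hx) hs)).trans k2)

lemma Bd.bds {R k : ℝ} {u u1 u2 : ℝ → ℝ} (hb : Bd R k u) (h : C2 u u1 u2) {x : ℝ} (hx : x ∈ Ioo (-R) R) :
    |u x| ≤ k ∧ |u1 x| ≤ k ∧ |u2 x| ≤ k := by
  have hk : 0 ≤ k := (abs_nonneg _).trans (hb.1 x (Ioo_subset_Icc_self hx))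
  refine ⟨hb.1 x (Ioo_subset_Icc_self hx), ?_, ?_⟩
  · apply (h.h1 x).le_of_lip' hk
    filter_upwards [isOpen_Ioo.mem_nhds hx] with y hy
    exact hb.2.1 y (Ioo_subset_Icc_self hy) x (Ioo_subset_Icc_self hx)
  · have h1 := h.of_cvx hb.2.2.1 hx
    have h2 := h.neg.of_cvx hb.2.2.2 hx
    rw [abs_le]; constructor <;> linarith

structure Sol (p α μ s0 t0 m : ℝ) (u ut ux uxx g : ℝ → ℝ → ℝ) : Prop where
  hC : ∀ t ∈ Icc s0 t0, C2 (u t) (ux t) (uxx t)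
  hd : ∀ x, ∀ t ∈ Icc s0 t0, HasDerivAt (fun s => u s x) (ut t x) t
  hc : ∀ x, ContinuousOn (fun t => ut t x) (Icc s0 t0)
  hm : ∀ t ∈ Icc s0 t0, Measurable (ut t)
  heq : ∀ t ∈ Icc s0 t0, ∀ x, ut t x = UU p μ (u t) (ux t) (uxx t) x + g t x
  hgi : ∀ t ∈ Icc s0 t0, Integrable (g t)
  hgm : ∀ t ∈ Icc s0 t0, ∫ x, |g t x| ≤ 2 * α * m
  hi : ∀ t ∈ Icc s0 t0, Integrable (u t)
  him : ∀ t ∈ Icc s0 t0, ∫ x, |u t x| ≤ m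
  hl : ∀ s ∈ Icc s0 t0, Tendsto (fun t => ∫ x, |u t x - u s x|) (𝓝[Icc s0 t0] s) (𝓝 0)

lemma UU_bd {p μ : ℝ} (hp : 0 < p) (hμ : 0 < μ) {R k : ℝ} {u u1 u2 : ℝ → ℝ} (hb : Bd R k u) (h : C2 u u1 u2)
    {x : ℝ} (hx : x ∈ Ioo (-R) R) : |UU p μ u u1 u2 x| ≤ k^p * k + μ * k := by
  obtain ⟨a, b, c⟩ := hb.bds h hx
  have hk : 0 ≤ k := (abs_nonneg _).trans a
  unfold UU
  refine (abs_add_le _ _).trans ?_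
  rw [abs_neg, abs_mul, abs_mul, abs_of_pos hμ, abs_of_nonneg (show 0 ≤ |u x|^p by positivity)]
  gcongr

noncomputable abbrev nu (R : ℝ) : Measure ℝ := volume.restrict (Ioc (-R) R)

lemma int_nu {R : ℝ} (hR : 0 < R) (F : ℝ → ℝ) : ∫ x, F x ∂(nu R) = ∫ x in -R..R, F x := by
  rw [intervalIntegral.integral_of_le (by linarith)]

lemma intble_nu {R : ℝ} {F : ℝ → ℝ} (h : Continuous F) : Integrable F (nu R) := h.integrableOn_Ioc

lemma ae_nu (R : ℝ) : ∀ᵐ x ∂(nu R), x ∈ Ioo (-R) R := by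
  rw [nu, ← Measure.restrict_congr_set Ioo_ae_eq_Ioc]
  exact ae_restrict_mem measurableSet_Ioo

lemma intble_of_le {R : ℝ} {F : ℝ → ℝ} (h : Integrable F) : Integrable F (nu R) := h.restrict

lemma abs_nu_le {R : ℝ} {F : ℝ → ℝ} (h : Integrable F) : ∫ x, |F x| ∂(nu R) ≤ ∫ x, |F x| :=
  setIntegral_le_integral h.abs (Eventually.of_forall fun _ => abs_nonneg _)

lemma const_nu {R : ℝ} (hR : 0 < R) (c : ℝ) : ∫ _x, c ∂(nu R) = 2 * R * c := by
  rw [int_nu hR, intervalIntegral.integral_const, smul_eq_mul]; ring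

/-- Bounded measurable multiple of integrable. -/
lemma intble_mul {ν : Measure ℝ} {F G : ℝ → ℝ} (hF : Integrable F ν) (hG : AEStronglyMeasurable G ν) {c : ℝ}
    (hb : ∀ᵐ x ∂ν, |G x| ≤ c) : Integrable (fun x => G x * F x) ν :=
  hF.bdd_mul hG hb

lemma sub_bound {p α μ : ℝ} (hp : 0 < p) (hμ : 0 < μ) {R : ℝ} (hR : 0 < R) {C : ℝ} {f T Th Q : ℝ → ℝ}
    (hS : Scal p C f T Th Q) {κ : ℝ} (hκ : 0 < κ) {k m Λ : ℝ} {a a1 a2 z z1 z2 g E : ℝ → ℝ}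
    (ha : C2 a a1 a2) (hz : C2 z z1 z2) (hb : Bd R k z) (hE : Continuous E) (hE1 : ∀ x, |E x| ≤ 1)
    (hg : Integrable g) (hgm : ∫ x, |g x| ≤ 2*α*m)
    (hA : (∫ x in -R..R, E x * (UU p μ a a1 a2 x - UU p μ z z1 z2 x) * rh R x)
     + κ * (∫ x in -R..R, T (a x) * UU p μ a a1 a2 x * rh R x)
     + κ * (∫ x in -R..R, T (z x) * UU p μ z z1 z2 x * rh R x) ≤ Λ) :
    ∫ x, rh R x * ((E x + κ * T (a x)) * (UU p μ a a1 a2 x + g x)) ∂(nu R)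
      ≤ Λ + (1 + κ*C) * (2*α*m + 2*R*(k^p*k+μ*k)) := by
  have cU := ha.cU hp μ
  have cV := hz.cU hp μ
  have cr := cont_rh R
  have cTa : Continuous fun x => T (a x) := hS.cT.comp ha.c0
  have cTz : Continuous fun x => T (z x) := hS.cT.comp hz.c0
  have C0 := hS.C0
  set U := UU p μ a a1 a2
  set V := UU p μ z z1 z2
  set M := k^p*k+μ*k
  have i1 : Integrable (fun x => E x * (U x - V x) * rh R x) (nu R) :=
    intble_nu ((hE.mul (cU.sub cV)).mul cr)
  have i2 : Integrable (fun x => T (a x) * U x * rh R x) (nu R) := intble_nu ((cTa.mul cU).mul cr)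
  have i3 : Integrable (fun x => T (z x) * V x * rh R x) (nu R) := intble_nu ((cTz.mul cV).mul cr)
  have i4 : Integrable (fun x => (1+κ*C) * (|g x| + M)) (nu R) :=
    ((intble_of_le hg.abs).add (integrable_const _)).const_mul _
  have hle : ∀ᵐ x ∂(nu R), rh R x * ((E x + κ * T (a x)) * (U x + g x)) ≤
     ((E x * (U x - V x) * rh R x + κ * (T (a x) * U x * rh R x)) + κ * (T (z x) * V x * rh R x))
      + (1+κ*C) * (|g x| + M) := by
    filter_upwards [ae_nu R] with x hx
    have hV : |V x| ≤ M := UU_bd hp hμ hb hz hx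
    have r0 := rh_nonneg (R := R) x
    have r1 := rh_le hR (Ioo_subset_Icc_self hx)
    have e : rh R x * ((E x + κ * T (a x)) * (U x + g x)) = 
      ((E x * (U x - V x) * rh R x + κ * (T (a x) * U x * rh R x)) + κ * (T (z x) * V x * rh R x))
       + rh R x * ((E x + κ * T (a x)) * g x + (E x - κ * T (z x)) * V x) := by ring
    have Ta := hS.Tb (a x)
    have Tz := hS.Tb (z x)
    have n1 : |E x + κ * T (a x)| ≤ 1 + κ*C := by
      refine (abs_add_le _ _).trans (add_le_add (hE1 x) ?_)
      rw [abs_mul, abs_of_pos hκ]; gcongr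
    have n2 : |E x - κ * T (z x)| ≤ 1 + κ*C := by
      refine (abs_sub _ _).trans (add_le_add (hE1 x) ?_)
      rw [abs_mul, abs_of_pos hκ]; gcongr
    have n3 : |(E x + κ * T (a x)) * g x + (E x - κ * T (z x)) * V x| ≤ (1+κ*C) * (|g x| + M) := by
      refine (abs_add_le _ _).trans ?_
      rw [abs_mul, abs_mul, mul_add]
      gcongr
    have n4 : rh R x * ((E x + κ * T (a x)) * g x + (E x - κ * T (z x)) * V x) ≤ (1+κ*C) * (|g x| + M) := by
      have := le_abs_self (rh R x * ((E x + κ * T (a x)) * g x + (E x - κ * T (z x)) * V x))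
      rw [abs_mul, abs_of_nonneg r0] at this
      have h5 : rh R x * |(E x + κ * T (a x)) * g x + (E x - κ * T (z x)) * V x| ≤ 1 * |(E x + κ * T (a x)) * g x + (E x - κ * T (z x)) * V x| := by gcongr
      linarith
    rw [e]; linarith
  have hIntg : Integrable (fun x => rh R x * ((E x + κ * T (a x)) * (U x + g x))) (nu R) := by
    have e1 : Integrable (fun x => (rh R x * (E x + κ * T (a x))) * U x) (nu R) :=
      intble_nu ((cr.mul (hE.add (continuous_const.mul cTa))).mul cU)
    have e2 : Integrable (fun x => (rh R x * (E x + κ * T (a x))) * g x) (nu R) := by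
      apply intble_mul (intble_of_le hg) (cr.mul (hE.add (continuous_const.mul cTa))).aestronglyMeasurable
        (c := 1 * (1+κ*C))
      filter_upwards [ae_nu R] with x hx
      change |rh R x * (E x + κ * T (a x))| ≤ _
      rw [abs_mul, abs_of_nonneg (rh_nonneg _)]
      have n1 : |E x + κ * T (a x)| ≤ 1 + κ*C := by
        refine (abs_add_le _ _).trans (add_le_add (hE1 x) ?_)
        rw [abs_mul, abs_of_pos hκ]; gcongr; exact hS.Tb _
      exact mul_le_mul (rh_le hR (Ioo_subset_Icc_self hx)) n1 (abs_nonneg _) zero_le_one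
    refine (e1.add e2).congr (Eventually.of_forall fun x => ?_)
    simp only [Pi.add_apply]; ring
  have j1 : Integrable (fun x => E x * (U x - V x) * rh R x + κ * (T (a x) * U x * rh R x)) (nu R) :=
    i1.add (i2.const_mul κ)
  have j2 : Integrable (fun x => E x * (U x - V x) * rh R x + κ * (T (a x) * U x * rh R x)
     + κ * (T (z x) * V x * rh R x)) (nu R) := j1.add (i3.const_mul κ)
  have := integral_mono_ae hIntg (j2.add i4) hle
  refine this.trans ?_
  simp only [Pi.add_apply]
  rw [integral_add j2 i4, integral_add j1 (i3.const_mul κ), integral_add i1 (i2.const_mul κ),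
    integral_const_mul, integral_const_mul, integral_const_mul,
    integral_add (intble_of_le hg.abs) (integrable_const _), const_nu hR, int_nu hR, int_nu hR, int_nu hR]
  have k1 := (abs_nu_le (R := R) hg).trans hgm
  have k2 : (1 + κ * C) * ((∫ x, |g x| ∂(nu R)) + 2*R*M) ≤ (1+κ*C) * (2*α*m + 2*R*M) := by gcongr
  linarith

end Perron


namespace Perron
open Set Topology

lemma Lam_mono {μ R m ε ε' κ C : ℝ} (hμ : 0 < μ) (hR : 0 < R) (hm : 0 ≤ m) (hε : 0 < ε) (hκ : 0 < κ)
    (hC : 0 ≤ C) (h : ε ≤ ε') : Lam μ R m ε κ C ≤ Lam μ R m ε' κ C := by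
  have hε' : 0 < ε' := hε.trans_le h
  have hK : KK μ R m ε κ C ≤ KK μ R m ε' κ C := by unfold KK; gcongr
  have hK0 : 0 ≤ KK μ R m ε κ C := by unfold KK; positivity
  have hK1 : 0 ≤ KK μ R m ε' κ C := by unfold KK; positivity
  unfold Lam; gcongr

lemma Sol.m0 {p α μ s0 t0 m : ℝ} {u ut ux uxx g : ℝ → ℝ → ℝ} (h : Sol p α μ s0 t0 m u ut ux uxx g)
    {t : ℝ} (ht : t ∈ Icc s0 t0) : 0 ≤ m :=
  (integral_nonneg fun _ => abs_nonneg _).trans (h.him t ht)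

lemma Sol.imR {p α μ s0 t0 m : ℝ} {u ut ux uxx g : ℝ → ℝ → ℝ} (h : Sol p α μ s0 t0 m u ut ux uxx g)
    {R : ℝ} (hR : 0 < R) {t : ℝ} (ht : t ∈ Icc s0 t0) : ∫ x in -R..R, |u t x| ≤ m := by
  rw [← int_nu hR]; exact (abs_nu_le (h.hi t ht)).trans (h.him t ht)

lemma gap_sg {p : ℝ} (hp0 : 0 < p) (hp1 : p < 1) {α μ : ℝ} (hμ : 0 < μ) {R : ℝ} (hR : 0 < R)
    {C : ℝ} {f T Th Q : ℝ → ℝ} (hS : Scal p C f T Th Q) {κ : ℝ} (hκ : 0 < κ)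
    {s0 t0 m : ℝ} {u ut ux uxx g : ℝ → ℝ → ℝ} (h : Sol p α μ s0 t0 m u ut ux uxx g)
    {v v' : ℝ → ℝ → ℝ × ℝ}
    (hv : ∀ s ∈ Icc s0 t0, ∀ t ∈ Icc s0 t0, ∀ x, |rh R x * u t x - rh R x * u s x| ≤ ‖v t x - v s x‖)
    (hv' : ∀ t ∈ Icc s0 t0, ∀ x, |rh R x * ut t x| ≤ ‖v' t x‖) {k : ℝ} {a b : ℝ}
    (ha : a ∈ Icc s0 t0) (hB : Bd R k (u a)) (hb : b ∈ Icc s0 t0)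
    (hab : a < b) (hP : PP (nu R) s0 t0 v v' a b) {σ : ℝ} (hσ : σ = 1 ∨ σ = -1) {ε : ℝ} (hε : 0 < ε)
    (hε1 : ε ≤ 1) :
    (∫ x, rh R x * max (σ * (u b x - u a x)) 0 ∂(nu R)) ≤
      (Lam μ R m 1 κ C + (1 + κ*C) * (2*α*m + 2*R*(k^p*k+μ*k))) * (b - a) + R * ε
       + κ * C * ∫ x, rh R x * |u b x - u a x| ∂(nu R) := by
  have C0 := hS.C0
  have hm0 := h.m0 ha
  have cr := cont_rh R
  have ce1 := continuous_eta1 hε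
  have ce := continuous_eta ε
  have cT := hS.cT
  have cTh := hS.cTh
  have hσ1 : |σ| = 1 := by rcases hσ with rfl | rfl <;> simp
  have cza := (h.hC a ha).c0
  have czb := (h.hC b hb).c0
  set z := u a with hz
  set l := Lam μ R m 1 κ C + (1 + κ*C) * (2*α*m + 2*R*(k^p*k+μ*k)) with hl
  set e : ℝ → ℝ → ℝ := fun t x => rh R x * (eta ε (σ * (u t x - z x)) + κ * Th (u t x)) with he
  set e' : ℝ → ℝ → ℝ := fun t x => rh R x * ((σ * eta1 ε (σ * (u t x - z x)) + κ * T (u t x)) * ut t x) with he'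
  have bE : ∀ y, |σ * eta1 ε y| ≤ 1 := fun y => by
    rw [abs_mul, hσ1, one_mul, abs_of_nonneg (eta1_nonneg hε _)]; exact eta1_le hε _
  have hAdm : Adm (nu R) s0 t0 v v' e e' := by
    refine ⟨?_, ?_, ?_, ?_, 1 + κ*C, by positivity, ?_, ?_⟩
    · intro x t ht
      have h0 := h.hd x t ht
      have h1 := (hasDerivAt_eta hε (σ * (u t x - z x))).comp t ((h0.sub_const (z x)).const_mul σ)
      have h2 := ((hS.hTh (u t x)).comp t h0).const_mul κ
      refine ((h1.add h2).const_mul (rh R x)).congr_deriv ?_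
      simp only [he']; ring
    · intro x
      have c0 : ContinuousOn (fun t => u t x) (Icc s0 t0) :=
        fun t ht => (h.hd x t ht).continuousAt.continuousWithinAt
      have c1 := h.hc x
      have c2 : ContinuousOn (fun t => eta1 ε (σ * (u t x - z x))) (Icc s0 t0) :=
        ce1.comp_continuousOn (by fun_prop)
      have c3 : ContinuousOn (fun t => T (u t x)) (Icc s0 t0) := cT.comp_continuousOn c0
      simp only [he']; fun_prop
    · intro t ht
      have c0 := (h.hC t ht).c0
      apply intble_nu; simp only [he]; fun_prop
    · intro t ht
      have c0 := (h.hC t ht).c0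
      have c1 : Continuous fun x => σ * eta1 ε (σ * (u t x - z x)) + κ * T (u t x) := by fun_prop
      exact cr.measurable.mul (c1.measurable.mul (h.hm t ht))
    · intro s hs t ht x
      have r0 := rh_nonneg (R := R) x
      have := hv s hs t ht x
      rw [← mul_sub, abs_mul, abs_of_nonneg r0] at this
      simp only [he]
      rw [← mul_sub, abs_mul, abs_of_nonneg r0]
      have q1 := eta_lip hε (σ * (u t x - z x)) (σ * (u s x - z x))
      have q2 : |σ * (u t x - z x) - σ * (u s x - z x)| = |u t x - u s x| := by
        rw [← mul_sub, abs_mul, hσ1, one_mul]; congr 1; ring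
      rw [q2] at q1
      have q3 := mul_le_mul_of_nonneg_left (hS.Thl (u t x) (u s x)) hκ.le
      have q4 : |eta ε (σ * (u t x - z x)) + κ * Th (u t x) - (eta ε (σ * (u s x - z x)) + κ * Th (u s x))|
         ≤ (1 + κ*C) * |u t x - u s x| := by
        have : eta ε (σ * (u t x - z x)) + κ * Th (u t x) - (eta ε (σ * (u s x - z x)) + κ * Th (u s x))
          = (eta ε (σ * (u t x - z x)) - eta ε (σ * (u s x - z x))) + κ * (Th (u t x) - Th (u s x)) := by ring
        rw [this]
        refine (abs_add_le _ _).trans ?_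
        rw [abs_mul, abs_of_pos hκ]; linarith
      calc _ ≤ rh R x * ((1 + κ*C) * |u t x - u s x|) := by gcongr
        _ = (1 + κ*C) * (rh R x * |u t x - u s x|) := by ring
        _ ≤ _ := by gcongr
    · intro t ht x
      have := hv' t ht x
      have e1 : e' t x = (σ * eta1 ε (σ * (u t x - z x)) + κ * T (u t x)) * (rh R x * ut t x) := by
        simp only [he']; ring
      rw [e1, abs_mul]
      have : |σ * eta1 ε (σ * (u t x - z x)) + κ * T (u t x)| ≤ 1 + κ*C := by
        refine (abs_add_le _ _).trans (add_le_add (bE _) ?_)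
        rw [abs_mul, abs_of_pos hκ]; gcongr; exact hS.Tb _
      gcongr
  have hle : ∀ t ∈ Icc s0 t0, ∫ x, e' t x ∂(nu R) ≤ l := by
    intro t ht
    have c0 := (h.hC t ht).c0
    have hsub := sub_bound (Λ := Lam μ R m 1 κ C) (E := fun x => σ * eta1 ε (σ * (u t x - z x))) hp0 hμ hR hS hκ (h.hC t ht) (h.hC a ha) hB
      (by fun_prop) (fun x => bE _) (h.hgi t ht) (h.hgm t ht) (by
        refine le_trans ?_ (Lam_mono hμ hR hm0 hε hκ C0 hε1)
        rcases hσ with rfl | rfl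
        · simpa using A4 hp0 hp1 hS hμ hR hε hκ (h.hC t ht) (h.hC a ha) (h.imR hR ht) (h.imR hR ha)
        · have := A4 hp0 hp1 hS hμ hR hε hκ (h.hC a ha) (h.hC t ht) (h.imR hR ha) (h.imR hR ht)
          refine le_trans (le_of_eq ?_) this
          have e1 : ∀ x, -1 * eta1 ε (-1 * (u t x - z x)) * (UU p μ (u t) (ux t) (uxx t) x - UU p μ (u a) (ux a) (uxx a) x) * rh R x
             = eta1 ε (u a x - u t x) * (UU p μ (u a) (ux a) (uxx a) x - UU p μ (u t) (ux t) (uxx t) x) * rh R x := by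
            intro x
            have : -1 * (u t x - z x) = u a x - u t x := by rw [hz]; ring
            rw [this]; ring
          simp only [hz] at e1 ⊢
          simp_rw [e1]; ring)
    refine le_trans (le_of_eq ?_) hsub
    apply integral_congr_ae
    filter_upwards with x
    simp only [he', h.heq t ht x]
  have hPP := hP e e' l hAdm hle
  have hib : Integrable (e b) (nu R) := hAdm.hi b hb
  have hia : Integrable (e a) (nu R) := hAdm.hi a ha
  have i1 : Integrable (fun x => rh R x * max (σ * (u b x - z x)) 0) (nu R) := intble_nu (by fun_prop)
  have i2 : Integrable (fun x => (κ*C) * (rh R x * |u b x - z x|)) (nu R) := intble_nu (by fun_prop)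
  have key : ∫ x, (rh R x * max (σ * (u b x - z x)) 0 - ((ε/2) + (κ*C) * (rh R x * |u b x - z x|))) ∂(nu R)
     ≤ ∫ x, (e b x - e a x) ∂(nu R) := by
    apply integral_mono_ae (i1.sub ((integrable_const _).add i2)) (hib.sub hia)
    filter_upwards [ae_nu R] with x hx
    have r0 := rh_nonneg (R := R) x
    have r1 := rh_le hR (Ioo_subset_Icc_self hx)
    have q1 := le_eta hε (σ * (u b x - z x))
    have q2 := eta_le hε (σ * (u a x - z x))
    have q3 : σ * (u a x - z x) = 0 := by rw [hz]; ring
    have q4 := mul_le_mul_of_nonneg_left (hS.Thl (u b x) (u a x)) hκ.le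
    have q5 := mul_le_mul_of_nonneg_left (neg_abs_le (Th (u b x) - Th (u a x))) hκ.le
    have : e b x - e a x = rh R x * (eta ε (σ * (u b x - z x)) + κ * (Th (u b x) - Th (u a x)))
      - rh R x * eta ε (σ * (u a x - z x)) := by
      simp only [he]; ring
    rw [q3] at q2 this
    simp only [max_self, zero_add] at q2
    have s1 : rh R x * eta ε 0 ≤ 1 * (ε/2) := by
      apply mul_le_mul r1 q2 _ zero_le_one
      exact (le_max_right _ _).trans (le_eta hε 0)
    have s2 : rh R x * (max (σ * (u b x - z x)) 0 - κ * (C * |u b x - z x|)) ≤ rh R x * (eta ε (σ * (u b x - z x)) + κ * (Th (u b x) - Th (u a x))) := by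
      apply mul_le_mul_of_nonneg_left _ r0
      rw [hz] at q1 ⊢
      linarith
    have s3 : rh R x * (max (σ * (u b x - z x)) 0 - κ * (C * |u b x - z x|)) = rh R x * max (σ * (u b x - z x)) 0 - (κ*C) * (rh R x * |u b x - z x|) := by ring
    change rh R x * max (σ * (u b x - z x)) 0 - ((ε/2) + (κ*C) * (rh R x * |u b x - z x|)) ≤ e b x - e a x
    rw [this]; linarith
  have j2 : Integrable (fun x => (ε/2) + (κ*C) * (rh R x * |u b x - z x|)) (nu R) := (integrable_const _).add i2
  rw [integral_sub i1 j2, integral_add (integrable_const _) i2, const_nu hR, integral_const_mul,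
    integral_sub hib hia] at key
  linarith

lemma gap_one {p : ℝ} (hp0 : 0 < p) (hp1 : p < 1) {α μ : ℝ} (hμ : 0 < μ) {R : ℝ} (hR : 0 < R)
    {s0 t0 m : ℝ} {u ut ux uxx g : ℝ → ℝ → ℝ} (h : Sol p α μ s0 t0 m u ut ux uxx g) (k : ℝ) :
    ∃ L, ∀ v v' : ℝ → ℝ → ℝ × ℝ, 
    (∀ s ∈ Icc s0 t0, ∀ t ∈ Icc s0 t0, ∀ x, |rh R x * u t x - rh R x * u s x| ≤ ‖v t x - v s x‖) →
    (∀ t ∈ Icc s0 t0, ∀ x, |rh R x * ut t x| ≤ ‖v' t x‖) → ∀ a b : ℝ,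
    a ∈ Icc s0 t0 → Bd R k (u a) → b ∈ Icc s0 t0 → a < b → PP (nu R) s0 t0 v v' a b →
    ∫ x, rh R x * |u b x - u a x| ∂(nu R) ≤ L * (b - a) := by
  obtain ⟨C, f, T, Th, Q, hS⟩ := exists_scal p hp0 hp1
  have C0 := hS.C0
  set κ := 1/(4*(C+1)) with hκd
  have hκ : 0 < κ := by positivity
  have hκC : κ * C ≤ 1/4 := by
    rw [hκd, div_mul_eq_mul_div, div_le_div_iff₀ (by positivity) (by norm_num)]; linarith
  set l := Lam μ R m 1 κ C + (1 + κ*C) * (2*α*m + 2*R*(k^p*k+μ*k)) with hl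
  refine ⟨4*l, ?_⟩
  intro v v' hv hv' a b ha hB hb hab hP
  have cza := (h.hC a ha).c0
  have czb := (h.hC b hb).c0
  have cr := cont_rh R
  set X := ∫ x, rh R x * |u b x - u a x| ∂(nu R) with hX
  have hX0 : 0 ≤ X := integral_nonneg fun x => mul_nonneg (rh_nonneg x) (abs_nonneg _)
  have main : ∀ ε, 0 < ε → ε ≤ 1 → X ≤ 4*l*(b-a) + 4*R*ε := by
    intro ε hε hε1
    have g1 := gap_sg hp0 hp1 hμ hR hS hκ h hv hv' ha hB hb hab hP (σ := 1) (Or.inl rfl) hε hε1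
    have g2 := gap_sg hp0 hp1 hμ hR hS hκ h hv hv' ha hB hb hab hP (σ := -1) (Or.inr rfl) hε hε1
    have e : X = (∫ x, rh R x * max (1 * (u b x - u a x)) 0 ∂(nu R)) + ∫ x, rh R x * max (-1 * (u b x - u a x)) 0 ∂(nu R) := by
      rw [← integral_add (intble_nu (by fun_prop)) (intble_nu (by fun_prop)), hX]
      congr 1; ext x
      rw [← mul_add]; congr 1
      rcases le_total 0 (u b x - u a x) with h | h
      · rw [abs_of_nonneg h, max_eq_left (by linarith), max_eq_right (by linarith)]; ring
      · rw [abs_of_nonpos h, max_eq_right (by linarith), max_eq_left (by linarith)]; ring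
    rw [← hl, ← hX] at g1 g2
    have : κ * C * X ≤ 1/4 * X := by gcongr
    linarith
  apply le_of_forall_pos_le_add
  intro d hd
  have := main (min 1 (d/(4*R))) (by positivity) (min_le_left _ _)
  have h2 : 4*R*(min 1 (d/(4*R))) ≤ d := by
    calc 4*R*(min 1 (d/(4*R))) ≤ 4*R*(d/(4*R)) := by gcongr; exact min_le_right _ _
      _ = d := by field_simp
  linarith

end Perron


namespace Perron
open Set Topology

lemma Bd_closed {p α μ s0 t0 m : ℝ} {u ut ux uxx g : ℝ → ℝ → ℝ} (h : Sol p α μ s0 t0 m u ut ux uxx g)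
    (R k : ℝ) : IsClosed {t | t ∈ Icc s0 t0 ∧ Bd R k (u t)} := by
  apply IsSeqClosed.isClosed
  intro tn t htn hlim
  have ht : t ∈ Icc s0 t0 := isClosed_Icc.mem_of_tendsto hlim (Eventually.of_forall fun n => (htn n).1)
  refine ⟨ht, Bd_lim (fun n => (htn n).2) fun x => ?_⟩
  exact (h.hd x t ht).continuousAt.tendsto.comp hlim

lemma Sol.int_rut {p α μ s0 t0 m : ℝ} (hp : 0 < p) {u ut ux uxx g : ℝ → ℝ → ℝ} (h : Sol p α μ s0 t0 m u ut ux uxx g)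
    {R : ℝ} (hR : 0 < R) {t : ℝ} (ht : t ∈ Icc s0 t0) : Integrable (fun x => rh R x * ut t x) (nu R) := by
  have cr := cont_rh R
  have e1 : Integrable (fun x => rh R x * UU p μ (u t) (ux t) (uxx t) x) (nu R) :=
    intble_nu (cr.mul ((h.hC t ht).cU hp μ))
  have e2 : Integrable (fun x => rh R x * g t x) (nu R) := by
    apply intble_mul (intble_of_le (h.hgi t ht)) cr.aestronglyMeasurable (c := 1)
    filter_upwards [ae_nu R] with x hx
    rw [abs_of_nonneg (rh_nonneg _)]; exact rh_le hR (Ioo_subset_Icc_self hx)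
  refine (e1.add e2).congr (Eventually.of_forall fun x => ?_)
  simp only [Pi.add_apply, h.heq t ht x]; ring

lemma Sol.bd_rut {p α μ s0 t0 m : ℝ} (hp : 0 < p) (hμ : 0 < μ) {u ut ux uxx g : ℝ → ℝ → ℝ} (h : Sol p α μ s0 t0 m u ut ux uxx g)
    {R : ℝ} (hR : 0 < R) {t : ℝ} (ht : t ∈ Icc s0 t0) {k : ℝ} (hB : Bd R k (u t)) :
    ∫ x, |rh R x * ut t x| ∂(nu R) ≤ 2*R*(k^p*k+μ*k) + 2*α*m := by
  have i1 := (intble_of_le (R := R) (h.hgi t ht).abs)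
  calc ∫ x, |rh R x * ut t x| ∂(nu R) ≤ ∫ x, ((k^p*k+μ*k) + |g t x|) ∂(nu R) := by
        apply integral_mono_ae (h.int_rut hp hR ht).abs ((integrable_const _).add i1)
        filter_upwards [ae_nu R] with x hx
        have r0 := rh_nonneg (R := R) x
        have r1 := rh_le hR (Ioo_subset_Icc_self hx)
        have := UU_bd hp hμ hB (h.hC t ht) hx
        change |rh R x * ut t x| ≤ (k^p*k+μ*k) + |g t x|
        rw [abs_mul, abs_of_nonneg r0, h.heq t ht x]
        calc _ ≤ 1 * |UU p μ (u t) (ux t) (uxx t) x + g t x| := by gcongr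
          _ ≤ _ := by rw [one_mul]; exact (abs_add_le _ _).trans (by linarith)
    _ ≤ _ := by
        rw [integral_add (integrable_const _) i1, const_nu hR]
        have := (abs_nu_le (R := R) (h.hgi t ht)).trans (h.hgm t ht)
        linarith

lemma prod_norm_le (a b : ℝ) : ‖(a, b)‖ ≤ |a| + |b| := by
  rw [Prod.norm_mk]; exact max_le (by simp) (by simp)

theorem PP_sol {p : ℝ} (hp0 : 0 < p) (hp1 : p < 1) {α μ : ℝ} (hμ : 0 < μ) {R : ℝ} (hR : 0 < R)
    {s0 t0 m : ℝ} (h0 : s0 ≤ t0) {u ut ux uxx g : ℝ → ℝ → ℝ} (h : Sol p α μ s0 t0 m u ut ux uxx g)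
    {u' ut' ux' uxx' g' : ℝ → ℝ → ℝ} (h' : Sol p α μ s0 t0 m u' ut' ux' uxx' g') :
    PP (nu R) s0 t0 (fun t x => (rh R x * u t x, rh R x * u' t x))
      (fun t x => (rh R x * ut t x, rh R x * ut' t x)) s0 t0 := by
  have cr := cont_rh R
  set B : ℕ → Set ℝ := fun k => {t | t ∈ Icc s0 t0 ∧ Bd R k (u t)} ∩ {t | t ∈ Icc s0 t0 ∧ Bd R k (u' t)} with hBd
  have i1 : ∀ t ∈ Icc s0 t0, Integrable (fun x => rh R x * u t x) (nu R) := fun t ht =>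
    intble_nu (cr.mul (h.hC t ht).c0)
  have i2 : ∀ t ∈ Icc s0 t0, Integrable (fun x => rh R x * u' t x) (nu R) := fun t ht =>
    intble_nu (cr.mul (h'.hC t ht).c0)
  apply perron h0 (B := B)
  · intro t ht
    exact (i1 t ht).prodMk (i2 t ht)
  · intro s hs
    have hsum := (h.hl s hs).add (h'.hl s hs)
    rw [add_zero] at hsum
    refine squeeze_zero' (Eventually.of_forall fun t => integral_nonneg fun _ => norm_nonneg _) ?_ hsum
    filter_upwards [self_mem_nhdsWithin] with t ht
    have j1 : Integrable (fun x => |u t x - u s x|) := ((h.hi t ht).sub (h.hi s hs)).abs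
    have j2 : Integrable (fun x => |u' t x - u' s x|) := ((h'.hi t ht).sub (h'.hi s hs)).abs
    calc _ ≤ ∫ x, (|u t x - u s x| + |u' t x - u' s x|) ∂(nu R) := by
          apply integral_mono_ae (((i1 t ht).prodMk (i2 t ht)).sub ((i1 s hs).prodMk (i2 s hs))).norm
            ((intble_of_le j1).add (intble_of_le j2))
          filter_upwards [ae_nu R] with x hx
          have r0 := rh_nonneg (R := R) x
          have r1 := rh_le hR (Ioo_subset_Icc_self hx)
          change ‖(rh R x * u t x - rh R x * u s x, rh R x * u' t x - rh R x * u' s x)‖ ≤ |u t x - u s x| + |u' t x - u' s x|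
          refine (prod_norm_le _ _).trans ?_
          rw [← mul_sub, ← mul_sub, abs_mul, abs_mul, abs_of_nonneg r0]
          have a1 := abs_nonneg (u t x - u s x)
          have a2 := abs_nonneg (u' t x - u' s x)
          nlinarith
      _ ≤ _ := by
          rw [integral_add (intble_of_le j1) (intble_of_le j2)]
          exact add_le_add (abs_nu_le ((h.hi t ht).sub (h.hi s hs))) (abs_nu_le ((h'.hi t ht).sub (h'.hi s hs)))
  · intro k
    exact (Bd_closed h R k).inter (Bd_closed h' R k)
  · intro t ht
    obtain ⟨k1, hk1⟩ := (h.hC t ht).exists_Bd R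
    obtain ⟨k2, hk2⟩ := (h'.hC t ht).exists_Bd R
    obtain ⟨n, hn⟩ := exists_nat_ge (max k1 k2)
    exact mem_iUnion.2 ⟨n, ⟨ht, hk1 n ((le_max_left _ _).trans hn)⟩, ⟨ht, hk2 n ((le_max_right _ _).trans hn)⟩⟩
  · intro k
    refine ⟨(2*R*((k:ℝ)^p*k+μ*k) + 2*α*m) + (2*R*((k:ℝ)^p*k+μ*k) + 2*α*m), fun t ht => ?_⟩
    have htI := ht.2
    have j1 := h.int_rut hp0 hR htI
    have j2 := h'.int_rut hp0 hR htI
    refine ⟨j1.prodMk j2, ?_⟩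
    calc _ ≤ ∫ x, (|rh R x * ut t x| + |rh R x * ut' t x|) ∂(nu R) := by
          apply integral_mono (j1.prodMk j2).norm (j1.abs.add j2.abs)
          intro x
          exact prod_norm_le _ _
      _ ≤ _ := by
          rw [integral_add j1.abs j2.abs]
          exact add_le_add (h.bd_rut hp0 hμ hR htI ht.1.1.2) (h'.bd_rut hp0 hμ hR htI ht.1.2.2)
  · intro k
    obtain ⟨L, hL⟩ := gap_one hp0 hp1 hμ hR h (k:ℝ)
    obtain ⟨L', hL'⟩ := gap_one hp0 hp1 hμ hR h' (k:ℝ)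
    refine ⟨L + L', fun a ha b hb hab hP => ?_⟩
    have haI := ha.2
    have b1 := hL _ _ (fun s hs t ht x => norm_fst_le ((rh R x * u t x, rh R x * u' t x) - (rh R x * u s x, rh R x * u' s x)))
      (fun t ht x => norm_fst_le (rh R x * ut t x, rh R x * ut' t x)) a b haI ha.1.1.2 hb hab hP
    have b2 := hL' _ _ (fun s hs t ht x => norm_snd_le ((rh R x * u t x, rh R x * u' t x) - (rh R x * u s x, rh R x * u' s x)))
      (fun t ht x => norm_snd_le (rh R x * ut t x, rh R x * ut' t x)) a b haI ha.1.2.2 hb hab hP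
    have j1 : Integrable (fun x => rh R x * |u b x - u a x|) (nu R) :=
      intble_nu (cr.mul ((h.hC b hb).c0.sub (h.hC a haI).c0).abs)
    have j2 : Integrable (fun x => rh R x * |u' b x - u' a x|) (nu R) :=
      intble_nu (cr.mul ((h'.hC b hb).c0.sub (h'.hC a haI).c0).abs)
    calc _ ≤ ∫ x, (rh R x * |u b x - u a x| + rh R x * |u' b x - u' a x|) ∂(nu R) := by
          apply integral_mono (((i1 b hb).prodMk (i2 b hb)).sub ((i1 a haI).prodMk (i2 a haI))).norm (j1.add j2)
          intro x
          change ‖(rh R x * u b x - rh R x * u a x, rh R x * u' b x - rh R x * u' a x)‖ ≤ rh R x * |u b x - u a x| + rh R x * |u' b x - u' a x|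
          refine (prod_norm_le _ _).trans ?_
          rw [← mul_sub, ← mul_sub, abs_mul, abs_mul, abs_of_nonneg (rh_nonneg _)]
      _ ≤ _ := by rw [integral_add j1 j2]; linarith

end Perron


namespace Perron
open Set Topology

section conv
variable {J : ℝ → ℝ}

lemma conv_prod (hJ : Integrable J) {u : ℝ → ℝ} (hu : Integrable u) :
    Integrable (fun p : ℝ × ℝ => J (p.1 - p.2) * u p.2) (volume.prod volume) := by
  have := hu.convolution_integrand (ContinuousLinearMap.mul ℝ ℝ) hJ
  refine this.congr (Eventually.of_forall fun p => ?_)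
  simp [mul_comm]

lemma conv_ae (hJ : Integrable J) {u : ℝ → ℝ} (hu : Integrable u) :
    ∀ᵐ x, Integrable (fun y => J (x - y) * u y) := (conv_prod hJ hu).prod_right_ae

lemma conv_int (hJ : Integrable J) {u : ℝ → ℝ} (hu : Integrable u) :
    Integrable (fun x => ∫ y, J (x - y) * u y) := (conv_prod hJ hu).integral_prod_left

lemma conv_pair (hJ : Integrable J) {u ρ : ℝ → ℝ} (hu : Integrable u) (hρ : Continuous ρ) (hb : ∀ x, |ρ x| ≤ 1) :
    ∫ x, ρ x * (∫ y, J (x - y) * u y) = ∫ y, u y * ∫ x, J (x - y) * ρ x := by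
  have h : Integrable (Function.uncurry fun x y => ρ x * (J (x - y) * u y)) (volume.prod volume) := by
    have := (conv_prod hJ hu).bdd_mul (g := fun p : ℝ × ℝ => J (p.1 - p.2) * u p.2) (f := fun p : ℝ × ℝ => ρ p.1) (c := 1)
      (by fun_prop) (Eventually.of_forall fun p => hb p.1)
    exact this
  have h2 := integral_integral_swap h
  calc ∫ x, ρ x * (∫ y, J (x - y) * u y) = ∫ x, ∫ y, ρ x * (J (x - y) * u y) := by
        congr 1; ext x; rw [integral_const_mul]
    _ = ∫ y, ∫ x, ρ x * (J (x - y) * u y) := h2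
    _ = _ := by
        congr 1; ext y; rw [← integral_const_mul]; congr 1; ext x; ring

lemma conv_abs (hJpos : ∀ x, 0 ≤ J x) (hJ : Integrable J) (hJm : ∫ x, J x = 1) {u : ℝ → ℝ} (hu : Integrable u) :
    ∫ x, |∫ y, J (x - y) * u y| ≤ ∫ x, |u x| := by
  have h1 : ∫ x, |∫ y, J (x - y) * u y| ≤ ∫ x, 1 * ∫ y, J (x - y) * |u y| := by
    apply integral_mono (conv_int hJ hu).abs ((conv_int hJ hu.abs).const_mul 1)
    intro x
    simp only [one_mul]
    rw [← Real.norm_eq_abs]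
    refine (norm_integral_le_integral_norm _).trans (le_of_eq ?_)
    congr 1; ext y; rw [norm_mul, Real.norm_of_nonneg (hJpos _), Real.norm_eq_abs]
  refine h1.trans (le_of_eq ?_)
  rw [conv_pair hJ hu.abs (ρ := fun _ => 1) continuous_const (by simp)]
  congr 1; ext y
  simp only [mul_one]
  rw [integral_sub_right_eq_self (fun x => J x) y, hJm, mul_one]
end conv

noncomputable def rb (R x : ℝ) : ℝ := (max (zt R x) 0)^2
noncomputable def om (J : ℝ → ℝ) (R : ℝ) : ℝ := ∫ s, J s * min 1 (4*|s|/R)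

lemma cont_rb (R : ℝ) : Continuous (rb R) := by
  have := cont_zt R; unfold rb; fun_prop

lemma rb_nonneg (R x : ℝ) : 0 ≤ rb R x := by unfold rb; positivity
lemma rb_le (R x : ℝ) : rb R x ≤ 1 := by
  unfold rb
  have : max (zt R x) 0 ≤ 1 := max_le (zt_le x) zero_le_one
  have : 0 ≤ max (zt R x) 0 := le_max_right _ _
  nlinarith

lemma rb_eq {R : ℝ} (hR : 0 < R) {x : ℝ} (hx : x ∈ Icc (-R) R) : rb R x = rh R x := by
  unfold rb rh; rw [max_eq_left (zt_nonneg hR hx)]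

lemma rb_zero {R : ℝ} (hR : 0 < R) {x : ℝ} (hx : x ∉ Ioc (-R) R) : rb R x = 0 := by
  have h : R ≤ |x| := by
    by_contra hc
    push Not at hc
    have := abs_lt.1 hc
    exact hx ⟨this.1, this.2.le⟩
  have : 1 ≤ x^2/R^2 := by
    rw [le_div_iff₀ (by positivity), one_mul, ← sq_abs x]; gcongr
  unfold rb zt; rw [max_eq_right (by linarith)]; simp

lemma rb_repr {R : ℝ} (hR : 0 < R) (x : ℝ) : rb R x = (1 - (min (|x|/R) 1)^2)^2 := by
  unfold rb zt
  congr 1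
  have e : x^2/R^2 = (|x|/R)^2 := by rw [div_pow, sq_abs]
  rw [e]
  have h0 : 0 ≤ |x|/R := by positivity
  rcases le_total (|x|/R) 1 with h | h
  · rw [min_eq_left h, max_eq_left]; nlinarith
  · rw [min_eq_right h, max_eq_right (by nlinarith)]; ring

lemma rb_lip {R : ℝ} (hR : 0 < R) (y s : ℝ) : rb R (y + s) ≤ rb R y + min 1 (4*|s|/R) := by
  rcases le_total 1 (4*|s|/R) with h | h
  · rw [min_eq_left h]; linarith [rb_le R (y+s), rb_nonneg R y]
  rw [min_eq_right h, rb_repr hR, rb_repr hR]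
  have hd : |min (|y+s|/R) 1 - min (|y|/R) 1| ≤ |s|/R := by
    refine (abs_min_sub_min_le_max _ _ _ _).trans ?_
    rw [sub_self, abs_zero, max_eq_left (a := |(|y+s|/R - |y|/R)|) (abs_nonneg _), ← sub_div, abs_div, abs_of_pos hR]
    have h9 := abs_abs_sub_abs_le_abs_sub (y+s) y
    have e9 : y + s - y = s := by ring
    rw [e9] at h9
    exact div_le_div_of_nonneg_right h9 hR.le
  have hc0 : 0 ≤ min (|y+s|/R) 1 := by positivity
  have hc1 : min (|y+s|/R) 1 ≤ 1 := min_le_right _ _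
  have hd0 : 0 ≤ min (|y|/R) 1 := by positivity
  have hd1 : min (|y|/R) 1 ≤ 1 := min_le_right _ _
  have e4 : 4*|s|/R = 4*(|s|/R) := by ring
  rw [e4]
  set c := min (|y+s|/R) 1
  set d := min (|y|/R) 1
  set r := |s|/R
  have f1 : |c^2 - d^2| ≤ 2*r := by
    have : c^2 - d^2 = (c - d)*(c+d) := by ring
    rw [this, abs_mul, abs_of_nonneg (show 0 ≤ c + d by linarith), mul_comm]
    exact mul_le_mul (by linarith) hd (abs_nonneg _) (by norm_num)
  have g1 : (1-c^2)^2 - (1-d^2)^2 = -(c^2-d^2)*(2-c^2-d^2) := by ring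
  have g2 : -(c^2-d^2)*(2-c^2-d^2) ≤ (2*r)*2 := by
    have k1 : 0 ≤ 2-c^2-d^2 := by nlinarith
    have k2 : 2-c^2-d^2 ≤ 2 := by nlinarith
    exact mul_le_mul (by linarith [(abs_le.1 f1).1]) k2 k1 (by linarith [abs_nonneg (c^2-d^2)])
  linarith

lemma om_int {J : ℝ → ℝ} (hJ : Integrable J) {R : ℝ} (hR : 0 < R) :
    Integrable fun s => J s * min 1 (4*|s|/R) := by
  apply hJ.mul_bdd (c := 1) (Continuous.aestronglyMeasurable (by fun_prop))
  filter_upwards with s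
  rw [Real.norm_of_nonneg (by positivity)]; exact min_le_left _ _

lemma om_nonneg {J : ℝ → ℝ} (hJpos : ∀ x, 0 ≤ J x) {R : ℝ} (hR : 0 < R) : 0 ≤ om J R :=
  integral_nonneg fun s => mul_nonneg (hJpos s) (by positivity)

lemma om_tendsto {J : ℝ → ℝ} (hJpos : ∀ x, 0 ≤ J x) (hJ : Integrable J) : Tendsto (om J) atTop (𝓝 0) := by
  have : (0:ℝ) = ∫ s, (0:ℝ) ∂(volume : Measure ℝ) := by simp
  rw [this]
  unfold om
  apply tendsto_integral_filter_of_dominated_convergence J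
  · filter_upwards [eventually_gt_atTop 0] with R hR
    exact (om_int hJ hR).aestronglyMeasurable
  · filter_upwards [eventually_gt_atTop 0] with R hR
    filter_upwards with s
    rw [norm_mul, Real.norm_of_nonneg (hJpos s), Real.norm_of_nonneg (by positivity)]
    exact mul_le_of_le_one_right (hJpos s) (min_le_left _ _)
  · exact hJ
  · filter_upwards with s
    have h1 : Tendsto (fun R : ℝ => 4*|s|/R) atTop (𝓝 0) := tendsto_const_nhds.div_atTop tendsto_id
    have h2 : Tendsto (fun R : ℝ => min 1 (4*|s|/R)) atTop (𝓝 (min 1 0)) := tendsto_const_nhds.min h1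
    have h3 := h2.const_mul (J s)
    simpa using h3

lemma conv_rb {J : ℝ → ℝ} (hJpos : ∀ x, 0 ≤ J x) (hJ : Integrable J) (hJm : ∫ x, J x = 1) {R : ℝ} (hR : 0 < R) (y : ℝ) :
    ∫ x, J (x - y) * rb R x ≤ rb R y + om J R := by
  have e : ∫ x, J (x - y) * rb R x = ∫ s, J s * rb R (y + s) := by
    rw [← integral_add_right_eq_self (fun x => J (x - y) * rb R x) y]
    congr 1; ext s; rw [add_sub_cancel_right, add_comm s y]
  rw [e]
  have i1 : Integrable fun s => J s * rb R (y+s) := by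
    have := cont_rb R
    apply hJ.mul_bdd (c := 1) (Continuous.aestronglyMeasurable (by fun_prop))
    filter_upwards with s
    rw [Real.norm_of_nonneg (rb_nonneg _ _)]; exact rb_le _ _
  calc ∫ s, J s * rb R (y + s) ≤ ∫ s, (J s * rb R y + J s * min 1 (4*|s|/R)) := by
        apply integral_mono i1 ((hJ.mul_const _).add (om_int hJ hR))
        intro s
        change J s * rb R (y+s) ≤ J s * rb R y + J s * min 1 (4*|s|/R)
        rw [← mul_add]
        exact mul_le_mul_of_nonneg_left (rb_lip hR y s) (hJpos s)
    _ = _ := by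
        rw [integral_add (hJ.mul_const _) (om_int hJ hR), integral_mul_const, hJm, one_mul]; rfl

/-- nonlocal term -/
lemma nonlocal {J : ℝ → ℝ} (hJpos : ∀ x, 0 ≤ J x) (hJ : Integrable J) (hJm : ∫ x, J x = 1) {R : ℝ} (hR : 0 < R)
    {ε : ℝ} (hε : 0 < ε) {a b : ℝ → ℝ} (ha : Integrable a) (hb : Integrable b) (ca : Continuous a) (cb : Continuous b)
    {m : ℝ} (hma : ∫ x, |a x| ≤ m) (hmb : ∫ x, |b x| ≤ m) :
    ∫ x, rh R x * (eta1 ε (a x - b x) * (((∫ y, J (x-y) * a y) - a x) - ((∫ y, J (x-y) * b y) - b x))) ∂(nu R)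
      ≤ 2 * m * om J R + R * ε := by
  set w : ℝ → ℝ := fun x => a x - b x with hw
  have cw : Continuous w := ca.sub cb
  have iw : Integrable w := ha.sub hb
  have iwp : Integrable (fun x => max (w x) 0) := iw.pos_part
  have cr := cont_rh R
  have ce1 := continuous_eta1 hε
  set P : ℝ → ℝ := fun x => ∫ y, J (x-y) * max (w y) 0 with hP
  have iP : Integrable P := conv_int hJ iwp
  have P0 : ∀ x, 0 ≤ P x := fun x => integral_nonneg fun y => mul_nonneg (hJpos _) (le_max_right _ _)
  have rbd : ∀ᵐ x ∂(nu R), |rh R x| ≤ 1 := by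
    filter_upwards [ae_nu R] with x hx
    rw [abs_of_nonneg (rh_nonneg _)]; exact rh_le hR (Ioo_subset_Icc_self hx)
  have i1 : Integrable (fun x => rh R x * P x) (nu R) :=
    intble_mul (intble_of_le iP) cr.aestronglyMeasurable rbd
  have i2 : Integrable (fun x => rh R x * max (w x) 0) (nu R) := intble_nu (by fun_prop)
  have step1 : ∫ x, rh R x * (eta1 ε (w x) * (((∫ y, J (x-y) * a y) - a x) - ((∫ y, J (x-y) * b y) - b x))) ∂(nu R)
     ≤ ∫ x, (rh R x * P x - rh R x * max (w x) 0 + ε/2) ∂(nu R) := by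
    have hIntg : Integrable (fun x => rh R x * (eta1 ε (w x) * (((∫ y, J (x-y) * a y) - a x) - ((∫ y, J (x-y) * b y) - b x)))) (nu R) := by
      apply intble_mul _ cr.aestronglyMeasurable rbd
      apply intble_mul (c := 1)
      · exact intble_of_le (((conv_int hJ ha).sub ha).sub ((conv_int hJ hb).sub hb))
      · exact (ce1.comp cw).aestronglyMeasurable
      · filter_upwards with x
        rw [abs_of_nonneg (eta1_nonneg hε _)]; exact eta1_le hε _
    apply integral_mono_ae hIntg ((i1.sub i2).add (integrable_const _))
    filter_upwards [ae_nu R, ae_restrict_of_ae (conv_ae hJ ha), ae_restrict_of_ae (conv_ae hJ hb), ae_restrict_of_ae (conv_ae hJ iwp)] with x hx xa xb xw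
    change _ ≤ rh R x * P x - rh R x * max (w x) 0 + ε/2
    have r0 := rh_nonneg (R := R) x
    have r1 := rh_le hR (Ioo_subset_Icc_self hx)
    have n0 := eta1_nonneg hε (w x)
    have n1 := eta1_le hε (w x)
    have q1 : (∫ y, J (x-y) * a y) - (∫ y, J (x-y) * b y) ≤ P x := by
      rw [← integral_sub xa xb]
      apply integral_mono (xa.sub xb) xw
      intro y
      change J (x-y) * a y - J (x-y) * b y ≤ J (x-y) * max (w y) 0
      rw [← mul_sub]
      exact mul_le_mul_of_nonneg_left (le_max_left _ _) (hJpos _)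
    have q2 := le_mul_eta1 hε (w x)
    have q3 : eta1 ε (w x) * ((∫ y, J (x-y) * a y) - (∫ y, J (x-y) * b y)) ≤ P x := by
      calc _ ≤ eta1 ε (w x) * P x := by gcongr
        _ ≤ 1 * P x := by gcongr; exact P0 x
        _ = P x := one_mul _
    have q4 : eta1 ε (w x) * (((∫ y, J (x-y) * a y) - a x) - ((∫ y, J (x-y) * b y) - b x))
       ≤ P x - max (w x) 0 + ε/2 := by
      have : eta1 ε (w x) * (((∫ y, J (x-y) * a y) - a x) - ((∫ y, J (x-y) * b y) - b x))
        = eta1 ε (w x) * ((∫ y, J (x-y) * a y) - (∫ y, J (x-y) * b y)) - w x * eta1 ε (w x) := by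
        rw [hw]; ring
      linarith
    have q5 := mul_le_mul_of_nonneg_left q4 r0
    have q6 : rh R x * (ε/2) ≤ 1 * (ε/2) := by gcongr
    have q7 : rh R x * (P x - max (w x) 0 + ε/2) = rh R x * P x - rh R x * max (w x) 0 + rh R x * (ε/2) := by ring
    linarith
  have toR : ∀ F : ℝ → ℝ, ∫ x, rh R x * F x ∂(nu R) = ∫ x, rb R x * F x := by
    intro F
    rw [← setIntegral_eq_integral_of_forall_compl_eq_zero (s := Ioc (-R) R) (f := fun x => rb R x * F x)
      (fun x hx => by rw [rb_zero hR hx, zero_mul])]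
    apply setIntegral_congr_fun measurableSet_Ioc
    intro x hx
    simp only [rb_eq hR (Ioc_subset_Icc_self hx)]
  have crb := cont_rb R
  have rbb : ∀ x, |rb R x| ≤ 1 := fun x => by rw [abs_of_nonneg (rb_nonneg _ _)]; exact rb_le _ _
  have irb : Integrable (fun x => max (w x) 0 * rb R x) := by
    have := intble_mul iwp crb.aestronglyMeasurable (Eventually.of_forall rbb)
    simpa only [mul_comm] using this
  have step2 : ∫ x, rh R x * P x ∂(nu R) ≤ (∫ x, rh R x * max (w x) 0 ∂(nu R)) + (∫ x, max (w x) 0) * om J R := by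
    rw [toR, toR, hP, conv_pair hJ iwp crb rbb]
    calc ∫ y, max (w y) 0 * ∫ x, J (x-y) * rb R x ≤ ∫ y, (max (w y) 0 * rb R y + max (w y) 0 * om J R) := by
          apply integral_mono_of_nonneg
          · filter_upwards with y
            exact mul_nonneg (le_max_right _ _) (integral_nonneg fun x => mul_nonneg (hJpos _) (rb_nonneg _ _))
          · exact irb.add (iwp.mul_const _)
          · filter_upwards with y
            rw [← mul_add]
            exact mul_le_mul_of_nonneg_left (conv_rb hJpos hJ hJm hR y) (le_max_right _ _)
      _ = _ := by
          rw [integral_add irb (iwp.mul_const _), integral_mul_const]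
          simp only [mul_comm]
  have step3 : ∫ x, max (w x) 0 ≤ 2 * m := by
    calc ∫ x, max (w x) 0 ≤ ∫ x, (|a x| + |b x|) := by
          apply integral_mono iwp (ha.abs.add hb.abs)
          intro x
          exact max_le ((le_abs_self _).trans (abs_sub _ _)) (add_nonneg (abs_nonneg _) (abs_nonneg _))
      _ ≤ _ := by rw [integral_add ha.abs hb.abs]; linarith
  have step4 := mul_le_mul_of_nonneg_right step3 (om_nonneg hJpos hR)
  have j1 : Integrable (fun x => rh R x * P x - rh R x * max (w x) 0) (nu R) := i1.sub i2
  rw [integral_add j1 (integrable_const _), integral_sub i1 i2, const_nu hR] at step1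
  linarith

end Perron


namespace Perron
open Set Topology

lemma fixed_R {J : ℝ → ℝ} (hJpos : ∀ x, 0 ≤ J x) (hJ : Integrable J) (hJm : ∫ x, J x = 1)
    {p : ℝ} (hp0 : 0 < p) (hp1 : p < 1) {α μ : ℝ} (hα : 0 < α) (hμ : 0 < μ) {R : ℝ} (hR : 0 < R)
    {C : ℝ} {f T Th Q : ℝ → ℝ} (hS : Scal p C f T Th Q) {κ : ℝ} (hκ : 0 < κ) {ε : ℝ} (hε : 0 < ε)
    {s0 t0 m : ℝ} (h0 : s0 ≤ t0) {u ut ux uxx g : ℝ → ℝ → ℝ} (h : Sol p α μ s0 t0 m u ut ux uxx g)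
    {u' ut' ux' uxx' g' : ℝ → ℝ → ℝ} (h' : Sol p α μ s0 t0 m u' ut' ux' uxx' g')
    (hg : ∀ t ∈ Icc s0 t0, ∀ x, g t x = α * ((∫ y, J (x - y) * u t y) - u t x))
    (hg' : ∀ t ∈ Icc s0 t0, ∀ x, g' t x = α * ((∫ y, J (x - y) * u' t y) - u' t x)) :
    ∫ x, rh R x * max (u' t0 x - u t0 x) 0 ∂(nu R) ≤
      ∫ x, rh R x * max (u' s0 x - u s0 x) 0 ∂(nu R) + R * ε + 4 * κ * C * m
      + (Lam μ R m ε κ C + α * (2 * m * om J R + R * ε) + κ * C * (4 * α * m)) * (t0 - s0) := by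
  have C0 := hS.C0
  have hs0 : s0 ∈ Icc s0 t0 := ⟨le_rfl, h0⟩
  have ht0 : t0 ∈ Icc s0 t0 := ⟨h0, le_rfl⟩
  have hm0 := h.m0 hs0
  have cr := cont_rh R
  have ce1 := continuous_eta1 hε
  have ce := continuous_eta ε
  have cT := hS.cT
  have cTh := hS.cTh
  set l := Lam μ R m ε κ C + α * (2 * m * om J R + R * ε) + κ * C * (4 * α * m) with hl
  set e : ℝ → ℝ → ℝ := fun t x => rh R x * (eta ε (u' t x - u t x) + κ * Th (u' t x) + κ * Th (u t x)) with he
  set e' : ℝ → ℝ → ℝ := fun t x => rh R x * (eta1 ε (u' t x - u t x) * (ut' t x - ut t x)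
    + κ * (T (u' t x) * ut' t x) + κ * (T (u t x) * ut t x)) with he'
  have hAdm : Adm (nu R) s0 t0 (fun t x => (rh R x * u t x, rh R x * u' t x))
      (fun t x => (rh R x * ut t x, rh R x * ut' t x)) e e' := by
    refine ⟨?_, ?_, ?_, ?_, 2 * (1 + κ*C), by positivity, ?_, ?_⟩
    · intro x t ht
      have d0 := h.hd x t ht
      have d1 := h'.hd x t ht
      have h1 := (hasDerivAt_eta hε (u' t x - u t x)).comp t (d1.sub d0)
      have h2 := ((hS.hTh (u' t x)).comp t d1).const_mul κ
      have h3 := ((hS.hTh (u t x)).comp t d0).const_mul κ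
      exact ((h1.add h2).add h3).const_mul (rh R x)
    · intro x
      have c0 : ContinuousOn (fun t => u t x) (Icc s0 t0) :=
        fun t ht => (h.hd x t ht).continuousAt.continuousWithinAt
      have c0' : ContinuousOn (fun t => u' t x) (Icc s0 t0) :=
        fun t ht => (h'.hd x t ht).continuousAt.continuousWithinAt
      have c1 := h.hc x
      have c1' := h'.hc x
      have c2 : ContinuousOn (fun t => eta1 ε (u' t x - u t x)) (Icc s0 t0) :=
        ce1.comp_continuousOn (by fun_prop)
      have c3 : ContinuousOn (fun t => T (u t x)) (Icc s0 t0) := cT.comp_continuousOn c0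
      have c3' : ContinuousOn (fun t => T (u' t x)) (Icc s0 t0) := cT.comp_continuousOn c0'
      simp only [he']; fun_prop
    · intro t ht
      have c0 := (h.hC t ht).c0
      have c0' := (h'.hC t ht).c0
      apply intble_nu; simp only [he]; fun_prop
    · intro t ht
      have c0 := (h.hC t ht).c0
      have c0' := (h'.hC t ht).c0
      have m0 := h.hm t ht
      have m1 := h'.hm t ht
      have c1 : Measurable fun x => eta1 ε (u' t x - u t x) := Continuous.measurable (by fun_prop)
      have c2 : Measurable fun x => T (u' t x) := Continuous.measurable (by fun_prop)
      have c3 : Measurable fun x => T (u t x) := Continuous.measurable (by fun_prop)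
      have c4 := cr.measurable
      simp only [he']; fun_prop
    · intro s hs t ht x
      have r0 := rh_nonneg (R := R) x
      have n1 := norm_fst_le ((rh R x * u t x, rh R x * u' t x) - (rh R x * u s x, rh R x * u' s x))
      have n2 := norm_snd_le ((rh R x * u t x, rh R x * u' t x) - (rh R x * u s x, rh R x * u' s x))
      change |rh R x * u t x - rh R x * u s x| ≤ _ at n1
      change |rh R x * u' t x - rh R x * u' s x| ≤ _ at n2
      rw [← mul_sub, abs_mul, abs_of_nonneg r0] at n1 n2
      simp only [he]
      set N := ‖(rh R x * u t x, rh R x * u' t x) - (rh R x * u s x, rh R x * u' s x)‖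
      rw [← mul_sub, abs_mul, abs_of_nonneg r0]
      have q1 := eta_lip hε (u' t x - u t x) (u' s x - u s x)
      have q2 : |(u' t x - u t x) - (u' s x - u s x)| ≤ |u' t x - u' s x| + |u t x - u s x| := by
        have : (u' t x - u t x) - (u' s x - u s x) = (u' t x - u' s x) - (u t x - u s x) := by ring
        rw [this]; exact abs_sub _ _
      have q3 := mul_le_mul_of_nonneg_left (hS.Thl (u t x) (u s x)) hκ.le
      have q3' := mul_le_mul_of_nonneg_left (hS.Thl (u' t x) (u' s x)) hκ.le
      have q4 : |eta ε (u' t x - u t x) + κ * Th (u' t x) + κ * Th (u t x)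
          - (eta ε (u' s x - u s x) + κ * Th (u' s x) + κ * Th (u s x))|
         ≤ (1 + κ*C) * (|u' t x - u' s x| + |u t x - u s x|) := by
        have : eta ε (u' t x - u t x) + κ * Th (u' t x) + κ * Th (u t x)
          - (eta ε (u' s x - u s x) + κ * Th (u' s x) + κ * Th (u s x))
          = (eta ε (u' t x - u t x) - eta ε (u' s x - u s x)) + κ * (Th (u' t x) - Th (u' s x))
            + κ * (Th (u t x) - Th (u s x)) := by ring
        rw [this]
        refine (abs_add_three _ _ _).trans ?_
        rw [abs_mul, abs_mul, abs_of_pos hκ]; linarith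
      calc _ ≤ rh R x * ((1 + κ*C) * (|u' t x - u' s x| + |u t x - u s x|)) := by gcongr
        _ = (1 + κ*C) * (rh R x * |u' t x - u' s x| + rh R x * |u t x - u s x|) := by ring
        _ ≤ (1 + κ*C) * (N + N) := by gcongr
        _ = _ := by ring
    · intro t ht x
      have n1 := norm_fst_le (rh R x * ut t x, rh R x * ut' t x)
      have n2 := norm_snd_le (rh R x * ut t x, rh R x * ut' t x)
      change |rh R x * ut t x| ≤ _ at n1
      change |rh R x * ut' t x| ≤ _ at n2
      change |e' t x| ≤ 2 * (1 + κ*C) * ‖(rh R x * ut t x, rh R x * ut' t x)‖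
      set N := ‖(rh R x * ut t x, rh R x * ut' t x)‖
      have hE : |eta1 ε (u' t x - u t x)| ≤ 1 := by
        rw [abs_of_nonneg (eta1_nonneg hε _)]; exact eta1_le hε _
      have b1 : |eta1 ε (u' t x - u t x) + κ * T (u' t x)| ≤ 1 + κ*C := by
        refine (abs_add_le _ _).trans (add_le_add hE ?_)
        rw [abs_mul, abs_of_pos hκ]; gcongr; exact hS.Tb _
      have b2 : |κ * T (u t x) - eta1 ε (u' t x - u t x)| ≤ 1 + κ*C := by
        refine (abs_sub _ _).trans ?_
        rw [add_comm]
        refine (add_le_add hE ?_)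
        rw [abs_mul, abs_of_pos hκ]; gcongr; exact hS.Tb _
      have e1 : e' t x = (eta1 ε (u' t x - u t x) + κ * T (u' t x)) * (rh R x * ut' t x)
         + (κ * T (u t x) - eta1 ε (u' t x - u t x)) * (rh R x * ut t x) := by
        simp only [he']; ring
      rw [e1]
      refine (abs_add_le _ _).trans ?_
      rw [abs_mul, abs_mul (κ * T (u t x) - eta1 ε (u' t x - u t x))]
      calc _ ≤ (1+κ*C) * N + (1+κ*C) * N := by gcongr
        _ = _ := by ring
  have hle : ∀ t ∈ Icc s0 t0, ∫ x, e' t x ∂(nu R) ≤ l := by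
    intro t ht
    have c0 := (h.hC t ht).c0
    have c0' := (h'.hC t ht).c0
    have cU := (h.hC t ht).cU hp0 μ
    have cU' := (h'.hC t ht).cU hp0 μ
    have a4 := A4 hp0 hp1 hS hμ hR hε hκ (h'.hC t ht) (h.hC t ht) (h'.imR hR ht) (h.imR hR ht)
    have nl := nonlocal hJpos hJ hJm hR hε (h'.hi t ht) (h.hi t ht) c0' c0 (h'.him t ht) (h.him t ht)
    set U := UU p μ (u t) (ux t) (uxx t)
    set U' := UU p μ (u' t) (ux' t) (uxx' t)
    have i1 : Integrable (fun x => eta1 ε (u' t x - u t x) * (U' x - U x) * rh R x) (nu R) := intble_nu (by fun_prop)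
    have i2 : Integrable (fun x => T (u' t x) * U' x * rh R x) (nu R) := intble_nu (by fun_prop)
    have i3 : Integrable (fun x => T (u t x) * U x * rh R x) (nu R) := intble_nu (by fun_prop)
    have i4 : Integrable (fun x => rh R x * (eta1 ε (u' t x - u t x) * (((∫ y, J (x-y) * u' t y) - u' t x) - ((∫ y, J (x-y) * u t y) - u t x)))) (nu R) := by
      have hF : Integrable (fun x => (((∫ y, J (x-y) * u' t y) - u' t x) - ((∫ y, J (x-y) * u t y) - u t x))) :=
        ((conv_int hJ (h'.hi t ht)).sub (h'.hi t ht)).sub ((conv_int hJ (h.hi t ht)).sub (h.hi t ht))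
      have := intble_mul (intble_of_le (R := R) hF) (G := fun x => rh R x * eta1 ε (u' t x - u t x)) (c := 1 * 1)
        (Continuous.aestronglyMeasurable (by fun_prop)) (by
          filter_upwards [ae_nu R] with x hx
          rw [abs_mul, abs_of_nonneg (rh_nonneg _), abs_of_nonneg (eta1_nonneg hε _)]
          exact mul_le_mul (rh_le hR (Ioo_subset_Icc_self hx)) (eta1_le hε _) (eta1_nonneg hε _) zero_le_one)
      refine this.congr (Eventually.of_forall fun x => ?_)
      simp only []; ring
    have i5 : Integrable (fun x => |g' t x|) (nu R) := intble_of_le (h'.hgi t ht).abs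
    have i6 : Integrable (fun x => |g t x|) (nu R) := intble_of_le (h.hgi t ht).abs
    have j1 := i1.add (i2.const_mul κ)
    have j2 := j1.add (i3.const_mul κ)
    have j3 := j2.add (i4.const_mul α)
    have j4 := j3.add (i5.const_mul (κ*C))
    have j5 := j4.add (i6.const_mul (κ*C))
    have hIntg : Integrable (e' t) (nu R) := by
      obtain ⟨K, hK0, -, hK⟩ := hAdm.hl
      have a1 := h.int_rut hp0 hR ht
      have a2 := h'.int_rut hp0 hR ht
      refine ((a1.prodMk a2).norm.const_mul K).mono' (hAdm.hm t ht).aestronglyMeasurable ?_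
      exact Eventually.of_forall fun x => hK t ht x
    have := integral_mono_ae hIntg j5 (by
      filter_upwards [ae_nu R] with x hx
      have r0 := rh_nonneg (R := R) x
      have r1 := rh_le hR (Ioo_subset_Icc_self hx)
      have k1 : ∀ s G : ℝ, rh R x * (T s * G) ≤ C * |G| := fun s G => by
        refine (le_abs_self _).trans ?_
        rw [abs_mul, abs_mul, abs_of_nonneg r0]
        calc rh R x * (|T s| * |G|) ≤ 1 * (C * |G|) := by gcongr; exact hS.Tb s
          _ = _ := one_mul _
      have k2 := mul_le_mul_of_nonneg_left (k1 (u' t x) (g' t x)) hκ.le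
      have k3 := mul_le_mul_of_nonneg_left (k1 (u t x) (g t x)) hκ.le
      simp only [Pi.add_apply, he']
      rw [h.heq t ht x, h'.heq t ht x]
      change rh R x * (eta1 ε (u' t x - u t x) * ((U' x + g' t x) - (U x + g t x)) + κ * (T (u' t x) * (U' x + g' t x)) + κ * (T (u t x) * (U x + g t x))) ≤ _
      have k4 : eta1 ε (u' t x - u t x) * (g' t x - g t x) = α * (eta1 ε (u' t x - u t x) * (((∫ y, J (x-y) * u' t y) - u' t x) - ((∫ y, J (x-y) * u t y) - u t x))) := by
        rw [hg t ht x, hg' t ht x]; ring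
      have k5 : rh R x * (eta1 ε (u' t x - u t x) * ((U' x + g' t x) - (U x + g t x)) + κ * (T (u' t x) * (U' x + g' t x)) + κ * (T (u t x) * (U x + g t x)))
        = eta1 ε (u' t x - u t x) * (U' x - U x) * rh R x + κ * (T (u' t x) * U' x * rh R x) + κ * (T (u t x) * U x * rh R x)
         + rh R x * (eta1 ε (u' t x - u t x) * (g' t x - g t x)) + κ * (rh R x * (T (u' t x) * g' t x)) + κ * (rh R x * (T (u t x) * g t x)) := by ring
      rw [k5, k4]
      linarith)
    refine this.trans ?_
    rw [integral_add' j4 (i6.const_mul (κ*C)), integral_add' j3 (i5.const_mul (κ*C)), integral_add' j2 (i4.const_mul α),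
      integral_add' j1 (i3.const_mul κ), integral_add' i1 (i2.const_mul κ)]
    simp only [integral_const_mul]
    rw [int_nu hR, int_nu hR (fun x => T (u' t x) * U' x * rh R x), int_nu hR (fun x => T (u t x) * U x * rh R x)]
    have k1 := mul_le_mul_of_nonneg_left ((abs_nu_le (R := R) (h.hgi t ht)).trans (h.hgm t ht)) (show 0 ≤ κ*C by positivity)
    have k2 := mul_le_mul_of_nonneg_left ((abs_nu_le (R := R) (h'.hgi t ht)).trans (h'.hgm t ht)) (show 0 ≤ κ*C by positivity)
    have k3 := mul_le_mul_of_nonneg_left nl hα.le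
    rw [hl]
    linarith
  have hPP := PP_sol hp0 hp1 hμ hR h0 h h' e e' l hAdm hle
  have hib : Integrable (e t0) (nu R) := hAdm.hi t0 ht0
  have hia : Integrable (e s0) (nu R) := hAdm.hi s0 hs0
  have bnd : ∀ t ∈ Icc s0 t0, ∫ x, κ * C * (|u' t x| + |u t x|) ∂(nu R) ≤ 2 * κ * C * m := by
    intro t ht
    rw [integral_const_mul, integral_add (intble_of_le (h'.hi t ht).abs) (intble_of_le (h.hi t ht).abs)]
    have k1 := mul_le_mul_of_nonneg_left ((abs_nu_le (R := R) (h.hi t ht)).trans (h.him t ht)) (show 0 ≤ κ*C by positivity)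
    have k2 := mul_le_mul_of_nonneg_left ((abs_nu_le (R := R) (h'.hi t ht)).trans (h'.him t ht)) (show 0 ≤ κ*C by positivity)
    linarith
  have pw : ∀ t x, x ∈ Ioo (-R) R → |rh R x * (κ * Th (u' t x) + κ * Th (u t x))| ≤ κ * C * (|u' t x| + |u t x|) := by
    intro t x hx
    have r0 := rh_nonneg (R := R) x
    have r1 := rh_le hR (Ioo_subset_Icc_self hx)
    rw [abs_mul, abs_of_nonneg r0]
    calc _ ≤ 1 * |κ * Th (u' t x) + κ * Th (u t x)| := by gcongr
      _ ≤ |κ * Th (u' t x)| + |κ * Th (u t x)| := by rw [one_mul]; exact abs_add_le _ _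
      _ = κ * |Th (u' t x)| + κ * |Th (u t x)| := by rw [abs_mul, abs_mul, abs_of_pos hκ]
      _ ≤ κ * (C * |u' t x|) + κ * (C * |u t x|) := by gcongr <;> exact hS.Thb _
      _ = _ := by ring
  have iM : ∀ t ∈ Icc s0 t0, Integrable (fun x => rh R x * max (u' t x - u t x) 0) (nu R) := fun t ht => by
    have c0 := (h.hC t ht).c0
    have c0' := (h'.hC t ht).c0
    exact intble_nu (by fun_prop)
  have iA : ∀ t ∈ Icc s0 t0, Integrable (fun x => κ * C * (|u' t x| + |u t x|)) (nu R) := fun t ht => by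
    have c0 := (h.hC t ht).c0
    have c0' := (h'.hC t ht).c0
    exact intble_nu (by fun_prop)
  have up : ∫ x, e s0 x ∂(nu R) ≤ ∫ x, (rh R x * max (u' s0 x - u s0 x) 0 + (κ * C * (|u' s0 x| + |u s0 x|) + ε/2)) ∂(nu R) := by
    apply integral_mono_ae hia ((iM s0 hs0).add ((iA s0 hs0).add (integrable_const _)))
    filter_upwards [ae_nu R] with x hx
    have r0 := rh_nonneg (R := R) x
    have r1 := rh_le hR (Ioo_subset_Icc_self hx)
    have q1 := (le_abs_self _).trans (pw s0 x hx)
    have q2 := mul_le_mul_of_nonneg_left (eta_le hε (u' s0 x - u s0 x)) r0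
    have q3 : rh R x * (ε/2) ≤ 1 * (ε/2) := by gcongr
    have q4 : e s0 x = rh R x * eta ε (u' s0 x - u s0 x) + rh R x * (κ * Th (u' s0 x) + κ * Th (u s0 x)) := by
      simp only [he]; ring
    rw [q4]
    change _ ≤ rh R x * max (u' s0 x - u s0 x) 0 + (κ * C * (|u' s0 x| + |u s0 x|) + ε/2)
    rw [mul_add] at q2
    linarith
  have lo : ∫ x, (rh R x * max (u' t0 x - u t0 x) 0 - κ * C * (|u' t0 x| + |u t0 x|)) ∂(nu R) ≤ ∫ x, e t0 x ∂(nu R) := by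
    apply integral_mono_ae ((iM t0 ht0).sub (iA t0 ht0)) hib
    filter_upwards [ae_nu R] with x hx
    have r0 := rh_nonneg (R := R) x
    have q1 := (neg_abs_le _).trans' (neg_le_neg (pw t0 x hx))
    have q2 := mul_le_mul_of_nonneg_left (le_eta hε (u' t0 x - u t0 x)) r0
    have q4 : e t0 x = rh R x * eta ε (u' t0 x - u t0 x) + rh R x * (κ * Th (u' t0 x) + κ * Th (u t0 x)) := by
      simp only [he]; ring
    rw [q4]
    change rh R x * max (u' t0 x - u t0 x) 0 - κ * C * (|u' t0 x| + |u t0 x|) ≤ _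
    linarith
  rw [integral_sub (iM t0 ht0) (iA t0 ht0)] at lo
  have jj : Integrable (fun x => κ * C * (|u' s0 x| + |u s0 x|) + ε/2) (nu R) := (iA s0 hs0).add (integrable_const _)
  rw [integral_add (iM s0 hs0) jj, integral_add (iA s0 hs0) (integrable_const _), const_nu hR] at up
  have b1 := bnd s0 hs0
  have b2 := bnd t0 ht0
  linarith

lemma toR {R : ℝ} (hR : 0 < R) (F : ℝ → ℝ) : ∫ x, rh R x * F x ∂(nu R) = ∫ x, rb R x * F x := by
  rw [← setIntegral_eq_integral_of_forall_compl_eq_zero (s := Ioc (-R) R) (f := fun x => rb R x * F x)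
    (fun x hx => by rw [rb_zero hR hx, zero_mul])]
  apply setIntegral_congr_fun measurableSet_Ioc
  intro x hx
  simp only [rb_eq hR (Ioc_subset_Icc_self hx)]

lemma rb_tendsto (x : ℝ) : Tendsto (fun R => rb R x) atTop (𝓝 1) := by
  have h1 : Tendsto (fun R : ℝ => (1 - (min (|x|/R) 1)^2)^2) atTop (𝓝 ((1 - (min 0 1)^2)^2)) :=
    ((tendsto_const_nhds.sub ((((tendsto_const_nhds (x := |x|)).div_atTop tendsto_id).min tendsto_const_nhds).pow 2))).pow 2
  have h2 : ((1:ℝ) - (min 0 1)^2)^2 = 1 := by norm_num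
  rw [h2] at h1
  refine h1.congr' ?_
  filter_upwards [eventually_gt_atTop 0] with R hR
  rw [rb_repr hR]

/-- The error term tends to zero. -/
lemma Lam_tendsto (μ m C : ℝ) (hμ : 0 < μ) :
    Tendsto (fun r : ℝ => Lam μ (r^2) m (1/r^4) (1/r) C) atTop (𝓝 0) := by
  have hr : Tendsto (fun r : ℝ => 1/r) atTop (𝓝 0) := by
    simpa using tendsto_inv_atTop_zero (𝕜 := ℝ)
  have e : ∀ᶠ r : ℝ in atTop, (fun s : ℝ => 
      2*(1/(4*μ)*(2+m*s^2) + 4*m*(1+s*C))*((1/(4*μ)*(2+m*s^2) + 4*m*(1+s*C))*s/(4*μ)+2*s^2)*(2+m*s^2)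
      + 12*μ*s^4*(2*m+2*s^2) + 24*μ*C*m*s^5) (1/r) = Lam μ (r^2) m (1/r^4) (1/r) C := by
    filter_upwards [eventually_gt_atTop 0] with r hr
    simp only [Lam, KK]
    field_simp
  refine Tendsto.congr' e ?_
  have hc : Continuous (fun s : ℝ => 
      2*(1/(4*μ)*(2+m*s^2) + 4*m*(1+s*C))*((1/(4*μ)*(2+m*s^2) + 4*m*(1+s*C))*s/(4*μ)+2*s^2)*(2+m*s^2)
      + 12*μ*s^4*(2*m+2*s^2) + 24*μ*C*m*s^5) := by fun_prop
  have h9 := (hc.tendsto 0).comp hr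
  convert h9 using 2
  congr 1; ring

lemma contraction {J : ℝ → ℝ} (hJpos : ∀ x, 0 ≤ J x) (hJ : Integrable J) (hJm : ∫ x, J x = 1)
    {p : ℝ} (hp0 : 0 < p) (hp1 : p < 1) {α μ : ℝ} (hα : 0 < α) (hμ : 0 < μ)
    {s0 t0 m : ℝ} (h0 : s0 ≤ t0) {u ut ux uxx g : ℝ → ℝ → ℝ} (h : Sol p α μ s0 t0 m u ut ux uxx g)
    {u' ut' ux' uxx' g' : ℝ → ℝ → ℝ} (h' : Sol p α μ s0 t0 m u' ut' ux' uxx' g')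
    (hg : ∀ t ∈ Icc s0 t0, ∀ x, g t x = α * ((∫ y, J (x - y) * u t y) - u t x))
    (hg' : ∀ t ∈ Icc s0 t0, ∀ x, g' t x = α * ((∫ y, J (x - y) * u' t y) - u' t x)) :
    ∫ x, max (u' t0 x - u t0 x) 0 ≤ ∫ x, max (u' s0 x - u s0 x) 0 := by
  obtain ⟨C, f, T, Th, Q, hS⟩ := exists_scal p hp0 hp1
  have hs0 : s0 ∈ Icc s0 t0 := ⟨le_rfl, h0⟩
  have ht0 : t0 ∈ Icc s0 t0 := ⟨h0, le_rfl⟩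
  have i0 : Integrable fun x => max (u' s0 x - u s0 x) 0 := ((h'.hi s0 hs0).sub (h.hi s0 hs0)).pos_part
  have i1 : Integrable fun x => max (u' t0 x - u t0 x) 0 := ((h'.hi t0 ht0).sub (h.hi t0 ht0)).pos_part
  have r2 : Tendsto (fun r : ℝ => r^2) atTop atTop := tendsto_pow_atTop (by norm_num)
  have hr : Tendsto (fun r : ℝ => 1/r) atTop (𝓝 0) := by
    simpa using tendsto_inv_atTop_zero (𝕜 := ℝ)
  have L : Tendsto (fun r : ℝ => ∫ x, rb (r^2) x * max (u' t0 x - u t0 x) 0) atTop (𝓝 (∫ x, max (u' t0 x - u t0 x) 0)) := by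
    apply tendsto_integral_filter_of_dominated_convergence (fun x => max (u' t0 x - u t0 x) 0)
    · exact Eventually.of_forall fun r => (cont_rb _).aestronglyMeasurable.mul i1.aestronglyMeasurable
    · refine Eventually.of_forall fun r => Eventually.of_forall fun x => ?_
      rw [Real.norm_of_nonneg (mul_nonneg (rb_nonneg _ _) (le_max_right _ _))]
      exact mul_le_of_le_one_left (le_max_right _ _) (rb_le _ _)
    · exact i1
    · refine Eventually.of_forall fun x => ?_
      simpa using ((rb_tendsto x).comp r2).mul_const (max (u' t0 x - u t0 x) 0)
  have Rt : Tendsto (fun r : ℝ => (∫ x, max (u' s0 x - u s0 x) 0) + (1/r)^2 + 4 * (1/r) * C * m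
      + (Lam μ (r^2) m (1/r^4) (1/r) C + α * (2 * m * om J (r^2) + (1/r)^2) + (1/r) * C * (4 * α * m)) * (t0 - s0)) atTop
      (𝓝 ((∫ x, max (u' s0 x - u s0 x) 0) + 0^2 + 4 * 0 * C * m
      + (0 + α * (2 * m * 0 + 0^2) + 0 * C * (4 * α * m)) * (t0 - s0))) := by
    have hom := (om_tendsto hJpos hJ).comp r2
    have hL := Lam_tendsto μ m C hμ
    exact ((tendsto_const_nhds.add (hr.pow 2)).add (((hr.const_mul 4).mul_const C).mul_const m)).add
      (((hL.add (((hom.const_mul (2*m)).add (hr.pow 2)).const_mul α)).add ((hr.mul_const C).mul_const _)).mul_const _)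
  have e0 : ((∫ x, max (u' s0 x - u s0 x) 0) + 0^2 + 4 * 0 * C * m
      + (0 + α * (2 * m * 0 + 0^2) + 0 * C * (4 * α * m)) * (t0 - s0)) = ∫ x, max (u' s0 x - u s0 x) 0 := by ring
  rw [e0] at Rt
  refine le_of_tendsto_of_tendsto L Rt ?_
  filter_upwards [eventually_gt_atTop 0] with r hr0
  have hR : 0 < r^2 := by positivity
  have key := fixed_R hJpos hJ hJm hp0 hp1 hα hμ hR hS (κ := 1/r) (by positivity) (ε := 1/r^4) (by positivity) h0 h h' hg hg'
  rw [toR hR, toR hR] at key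
  have e1 : r^2 * (1/r^4) = (1/r)^2 := by field_simp
  rw [e1] at key
  have k2 : ∫ x, rb (r^2) x * max (u' s0 x - u s0 x) 0 ≤ ∫ x, max (u' s0 x - u s0 x) 0 := by
    apply integral_mono_of_nonneg (Eventually.of_forall fun x => mul_nonneg (rb_nonneg _ _) (le_max_right _ _)) i0
    exact Eventually.of_forall fun x => mul_le_of_le_one_left (le_max_right _ _) (rb_le _ _)
  linarith

end Perron


namespace Perron
open Set Topology

section fin
variable {J : ℝ → ℝ} {q α μ : ℝ} {φ : ℝ → ℝ} {u : ℝ → ℝ → ℝ}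

lemma reg_bound (hu : IsRegSol J q α μ φ u) (s0 t0 : ℝ) (hs : 0 < s0) :
    ∃ m, ∀ t ∈ Icc s0 t0, ∫ x, |u t x| ≤ m := by
  obtain ⟨h1, h2, -⟩ := hu
  have hc : ContinuousOn (fun t => ∫ x, |u t x|) (Icc s0 t0) := by
    intro s hs'
    have hs0 : 0 ≤ s := hs.le.trans hs'.1
    have hlim := (h2 s hs0).mono_left (nhdsWithin_mono s (fun t (ht : t ∈ Icc s0 t0) => hs.le.trans ht.1))
    rw [ContinuousWithinAt, tendsto_iff_dist_tendsto_zero]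
    refine squeeze_zero' (Eventually.of_forall fun _ => dist_nonneg) ?_ hlim
    filter_upwards [self_mem_nhdsWithin] with t ht
    have ht0 : 0 ≤ t := hs.le.trans ht.1
    rw [Real.dist_eq, ← integral_sub (h1 t ht0).abs (h1 s hs0).abs]
    refine abs_integral_le_integral_abs.trans ?_
    exact integral_mono ((h1 t ht0).abs.sub (h1 s hs0).abs).abs ((h1 t ht0).sub (h1 s hs0)).abs
      (fun x => abs_abs_sub_abs_le_abs_sub _ _)
  obtain ⟨m, hm⟩ := isCompact_Icc.exists_bound_of_continuousOn hc
  exact ⟨m, fun t ht => (le_abs_self _).trans (hm t ht)⟩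

lemma reg_sol (hJpos : ∀ x, 0 ≤ J x) (hJ : Integrable J) (hJm : ∫ x, J x = 1) (hα : 0 < α)
    (hu : IsRegSol J q α μ φ u) {s0 t0 m : ℝ} (hs : 0 < s0) (hm : ∀ t ∈ Icc s0 t0, ∫ x, |u t x| ≤ m) :
    Sol (q-1) α μ s0 t0 m u (fun t x => deriv (fun s => u s x) t) (fun t => deriv (u t))
      (fun t => deriv (deriv (u t))) (fun t x => α * ((∫ y, J (x - y) * u t y) - u t x)) := by
  obtain ⟨h1, h2, h3, h4, h5, -⟩ := hu
  have pos : ∀ t ∈ Icc s0 t0, 0 < t := fun t ht => hs.trans_le ht.1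
  have hd : ∀ x, ∀ t, 0 < t → HasDerivAt (fun s => u s x) (deriv (fun s => u s x) t) t := fun x t ht =>
    (((h4 x).differentiableOn (by norm_num)).differentiableAt (Ioi_mem_nhds ht)).hasDerivAt
  have hgi : ∀ t ∈ Icc s0 t0, Integrable (fun x => (∫ y, J (x - y) * u t y) - u t x) := fun t ht =>
    (conv_int hJ (h1 t (pos t ht).le)).sub (h1 t (pos t ht).le)
  refine ⟨?_, fun x t ht => hd x t (pos t ht), ?_, ?_, ?_, fun t ht => (hgi t ht).const_mul α, ?_,
    fun t ht => h1 t (pos t ht).le, hm, ?_⟩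
  · intro t ht
    have hC := h3 t (pos t ht)
    have hC1 : ContDiff ℝ 1 (deriv (u t)) := ((contDiff_succ_iff_deriv (n := 1)).1 hC).2.2
    refine ⟨fun x => (hC.differentiable (by norm_num) x).hasDerivAt,
      fun x => (hC1.differentiable (by norm_num) x).hasDerivAt, hC1.continuous_deriv (by norm_num)⟩
  · intro x
    exact ((h4 x).continuousOn_deriv_of_isOpen isOpen_Ioi (by norm_num)).mono (fun t ht => pos t ht)
  · intro t ht
    have t0' := pos t ht
    have hlim : ∀ x, Tendsto (fun n : ℕ => ((n:ℝ)+1) * (u (t + 1/((n:ℝ)+1)) x - u t x)) atTop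
        (𝓝 (deriv (fun s => u s x) t)) := by
      intro x
      have hh := (hd x t t0').tendsto_slope_zero
      have hn : Tendsto (fun n : ℕ => 1/((n:ℝ)+1)) atTop (𝓝[≠] 0) := by
        rw [tendsto_nhdsWithin_iff]
        refine ⟨tendsto_one_div_add_atTop_nhds_zero_nat, Eventually.of_forall fun n => ?_⟩
        have : (0:ℝ) < 1/((n:ℝ)+1) := by positivity
        exact this.ne'
      refine (hh.comp hn).congr fun n => ?_
      simp [smul_eq_mul]
    refine measurable_of_tendsto_metrizable (f := fun (n : ℕ) x => ((n:ℝ)+1) * (u (t + 1/((n:ℝ)+1)) x - u t x)) ?_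
      (tendsto_pi_nhds.2 hlim)
    intro n
    have : 0 < t + 1/((n:ℝ)+1) := by positivity
    exact ((((h3 _ this).continuous).sub (h3 t t0').continuous).measurable).const_mul _
  · intro t ht x
    have := h5 t (pos t ht) x
    simp only [UU]
    linarith
  · intro t ht
    have i := h1 t (pos t ht).le
    calc ∫ x, |α * ((∫ y, J (x - y) * u t y) - u t x)| ≤ ∫ x, α * (|∫ y, J (x - y) * u t y| + |u t x|) := by
          apply integral_mono ((hgi t ht).const_mul α).abs (((conv_int hJ i).abs.add i.abs).const_mul α)
          intro x
          simp only [Pi.add_apply]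
          rw [abs_mul, abs_of_pos hα]
          gcongr
          exact abs_sub _ _
      _ ≤ _ := by
          rw [integral_const_mul, integral_add (conv_int hJ i).abs i.abs]
          have a1 := conv_abs hJpos hJ hJm i
          have a2 := hm t ht
          nlinarith
  · intro s hs'
    exact (h2 s (pos s hs').le).mono_left (nhdsWithin_mono s (fun t ht => (pos t ht).le))

lemma pos_contr (hJpos : ∀ x, 0 ≤ J x) (hJ : Integrable J) (hJm : ∫ x, J x = 1) (hq1 : 1 < q) (hq2 : q < 2)
    (hα : 0 < α) (hμ : 0 < μ) (hu : IsRegSol J q α μ φ u) {φ' : ℝ → ℝ} {u' : ℝ → ℝ → ℝ}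
    (hu' : IsRegSol J q α μ φ' u') {t : ℝ} (ht : 0 < t) :
    ∫ x, max (u' t x - u t x) 0 ≤ ∫ x, max (φ' x - φ x) 0 := by
  have step : ∀ s, 0 < s → s ≤ t → ∫ x, max (u' t x - u t x) 0 ≤ ∫ x, max (u' s x - u s x) 0 := by
    intro s hs hst
    obtain ⟨m1, hm1⟩ := reg_bound hu s t hs
    obtain ⟨m2, hm2⟩ := reg_bound hu' s t hs
    exact contraction hJpos hJ hJm (by linarith) (by linarith) hα hμ hst
      (reg_sol hJpos hJ hJm hα hu hs (fun r hr => (hm1 r hr).trans (le_max_left m1 m2)))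
      (reg_sol hJpos hJ hJm hα hu' hs (fun r hr => (hm2 r hr).trans (le_max_right m1 m2)))
      (fun _ _ _ => rfl) (fun _ _ _ => rfl)
  have e : ∫ x, max (φ' x - φ x) 0 = ∫ x, max (u' 0 x - u 0 x) 0 := by
    apply integral_congr_ae
    filter_upwards [hu.2.2.2.2.2, hu'.2.2.2.2.2] with x h1 h2
    rw [h1, h2]
  rw [e]
  have l1 := (hu.2.1 0 le_rfl).mono_left (nhdsWithin_mono 0 (Ioi_subset_Ici_self : Ioi (0:ℝ) ⊆ Ici 0))
  have l2 := (hu'.2.1 0 le_rfl).mono_left (nhdsWithin_mono 0 (Ioi_subset_Ici_self : Ioi (0:ℝ) ⊆ Ici 0))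
  have l3 := (l1.add l2).const_add (∫ x, max (u' 0 x - u 0 x) 0)
  rw [add_zero, add_zero] at l3
  refine ge_of_tendsto l3 ?_
  filter_upwards [Ioo_mem_nhdsGT ht] with s hs
  refine (step s hs.1 hs.2.le).trans ?_
  have a0 := hu.1 0 le_rfl
  have a1 := hu.1 s hs.1.le
  have b0 := hu'.1 0 le_rfl
  have b1 := hu'.1 s hs.1.le
  have p0 : Integrable fun x => max (u' 0 x - u 0 x) 0 := (b0.sub a0).pos_part
  have p1 : Integrable fun x => max (u' s x - u s x) 0 := (b1.sub a1).pos_part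
  have d1 : Integrable fun x => |u s x - u 0 x| := (a1.sub a0).abs
  have d2 : Integrable fun x => |u' s x - u' 0 x| := (b1.sub b0).abs
  have d3 : Integrable fun x => |u s x - u 0 x| + |u' s x - u' 0 x| := d1.add d2
  rw [← integral_add d1 d2, ← integral_add p0 d3]
  apply integral_mono p1 (p0.add d3)
  intro x
  change max (u' s x - u s x) 0 ≤ max (u' 0 x - u 0 x) 0 + (|u s x - u 0 x| + |u' s x - u' 0 x|)
  apply max_le
  · linarith [le_max_left (u' 0 x - u 0 x) 0, neg_abs_le (u s x - u 0 x), le_abs_self (u' s x - u' 0 x)]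
  · linarith [le_max_right (u' 0 x - u 0 x) 0, abs_nonneg (u s x - u 0 x), abs_nonneg (u' s x - u' 0 x)]

end fin

lemma abs_split {a b : ℝ → ℝ} (ha : Integrable a) (hb : Integrable b) :
    ∫ x, |b x - a x| = (∫ x, max (b x - a x) 0) + ∫ x, max (a x - b x) 0 := by
  have p0 : Integrable fun x => max (b x - a x) 0 := (hb.sub ha).pos_part
  have p1 : Integrable fun x => max (a x - b x) 0 := (ha.sub hb).pos_part
  rw [← integral_add p0 p1]
  congr 1; ext x
  rcases le_total (a x) (b x) with h | h
  · rw [abs_of_nonneg (by linarith), max_eq_left (by linarith), max_eq_right (by linarith)]; ring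
  · rw [abs_of_nonpos (by linarith), max_eq_right (by linarith), max_eq_left (by linarith)]; ring

end Perron

theorem stmt6
    (J : ℝ → ℝ) (hJpos : ∀ x, 0 ≤ J x) (hJeven : ∀ x, J (-x) = J x)
    (hJint : Integrable J) (hJmass : ∫ x, J x = 1)
    (q : ℝ) (hq1 : 1 < q) (hq2 : q < 2)
    (α μ : ℝ) (hα : 0 < α) (hμ : 0 < μ)
    (φ φt : ℝ → ℝ) (hφ : Integrable φ) (hφt : Integrable φt)
    (u ut : ℝ → ℝ → ℝ)
    (hu : IsRegSol J q α μ φ u) (hut : IsRegSol J q α μ φt ut) :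
    ∀ t : ℝ, 0 < t →
      (∫ x, max (ut t x - u t x) 0) ≤ (∫ x, max (φt x - φ x) 0) ∧
      (∫ x, |ut t x - u t x|) ≤ ∫ x, |φt x - φ x| := by
  intro t ht
  have h1 := Perron.pos_contr hJpos hJint hJmass hq1 hq2 hα hμ hu hut ht
  have h2 := Perron.pos_contr hJpos hJint hJmass hq1 hq2 hα hμ hut hu ht
  refine ⟨h1, ?_⟩
  rw [Perron.abs_split (hu.1 t ht.le) (hut.1 t ht.le), Perron.abs_split hφ hφt]
  exact add_le_add h1 h2
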